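/- Under hypotheses (H0)-(H4), for any q ∈ ℝ^{d−1}×[0,∞), any z ∈ ℤ^{d−1}×ℕ, and any sequences ε_n > 0 and z_n ∈ ℤ^{d−1}×ℕ with lim_n ε_n = 0 and lim_n ε_n·z_n = q, one has lim_{n→∞} ε_n·log G(z, z_n) = −sup_{a∈(Θ×ℝ)∩D} a·q. -/

import Mathlib

open scoped ENNReal
open Filter MeasureTheory

namespace ReflectedRW

/-- `ℤ^d` realized as `ℤ^{d-1} × ℤ`. -/
abbrev Zd (d : ℕ) := (Fin (d-1) → ℤ) × ℤ
/-- `ℝ^d` realized as `ℝ^{d-1} × ℝ`. -/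
abbrev Rd (d : ℕ) := (Fin (d-1) → ℝ) × ℝ
/-- The state space `ℤ^{d-1} × ℕ` of the reflected walk. -/
abbrev St (d : ℕ) := (Fin (d-1) → ℤ) × ℕ

/-- Embedding of the state space into `ℤ^d`. -/
def toZ (d : ℕ) (z : St d) : Zd d := (z.1, (z.2 : ℤ))

/-- Embedding of `ℤ^d` into `ℝ^d`. -/
def toR (d : ℕ) (z : Zd d) : Rd d := (fun i => (z.1 i : ℝ), (z.2 : ℝ))

/-- Scalar product `a · z` of `a ∈ ℝ^d` and `z ∈ ℤ^d`. -/
noncomputable def dotZ (d : ℕ) (a : Rd d) (z : Zd d) : ℝ :=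
  (∑ i, a.1 i * (z.1 i : ℝ)) + a.2 * (z.2 : ℝ)

/-- Scalar product on `ℝ^d`. -/
noncomputable def dotR (d : ℕ) (a q : Rd d) : ℝ :=
  (∑ i, a.1 i * q.1 i) + a.2 * q.2

/-- One-step transition probabilities of the reflected random walk `Z(t)`:
jumps with law `μ` in the interior and with law `μ0` on the boundary `y = 0`. -/
noncomputable def step (d : ℕ) (μ μ0 : Zd d → ℝ) (z z' : St d) : ℝ≥0∞ :=
  if z.2 = 0 then ENNReal.ofReal (μ0 (toZ d z' - toZ d z))
  else ENNReal.ofReal (μ (toZ d z' - toZ d z))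

/-- Real-valued version of the transition kernel of `Z(t)`. -/
noncomputable def stepR (d : ℕ) (μ μ0 : Zd d → ℝ) (z z' : St d) : ℝ :=
  if z.2 = 0 then μ0 (toZ d z' - toZ d z) else μ (toZ d z' - toZ d z)

/-- `n`-step kernel obtained by iterating a sub-Markov kernel `p`. -/
noncomputable def kerIter {S : Type*} [DecidableEq S] (p : S → S → ℝ≥0∞) :
    ℕ → S → S → ℝ≥0∞
  | 0, z, z' => if z = z' then 1 else 0
  | n+1, z, z' => ∑' w : S, kerIter p n z w * p w z'

/-- `n`-step transition probabilities of `Z(t)`: `P_z(Z(n) = z')`. -/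
noncomputable def stepn (d : ℕ) (μ μ0 : Zd d → ℝ) : ℕ → St d → St d → ℝ≥0∞ :=
  kerIter (step d μ μ0)

/-- Green's function `G(z,z') = ∑_{t ≥ 0} P_z(Z(t) = z')` of the reflected walk. -/
noncomputable def green (d : ℕ) (μ μ0 : Zd d → ℝ) (z z' : St d) : ℝ≥0∞ :=
  ∑' n : ℕ, stepn d μ μ0 n z z'

/-- Kernel of the walk killed upon hitting the boundary hyperplane `y = 0`. -/
noncomputable def stepKilled (d : ℕ) (μ μ0 : Zd d → ℝ) (z z' : St d) : ℝ≥0∞ :=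
  if z'.2 = 0 then 0 else step d μ μ0 z z'

/-- `n`-step kernel of the killed walk: `P_z(Z(n) = z', τ > n)` where
`τ` is the first return time to the boundary hyperplane. -/
noncomputable def stepKilledn (d : ℕ) (μ μ0 : Zd d → ℝ) : ℕ → St d → St d → ℝ≥0∞ :=
  kerIter (stepKilled d μ μ0)

/-- Green's function `G₊(z,z')` of the killed walk. -/
noncomputable def greenPlus (d : ℕ) (μ μ0 : Zd d → ℝ) (z z' : St d) : ℝ≥0∞ :=
  ∑' n : ℕ, stepKilledn d μ μ0 n z z'

/-- One-step kernel of the homogeneous random walk `S(t)` on `ℤ^d`. -/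
noncomputable def stepS (d : ℕ) (μ : Zd d → ℝ) (z z' : Zd d) : ℝ≥0∞ :=
  ENNReal.ofReal (μ (z' - z))

/-- `n`-step kernel of the homogeneous random walk on `ℤ^d`. -/
noncomputable def stepSn (d : ℕ) (μ : Zd d → ℝ) : ℕ → Zd d → Zd d → ℝ≥0∞ :=
  kerIter (stepS d μ)

/-- Green's function `G_S` of the homogeneous random walk on `ℤ^d`. -/
noncomputable def greenS (d : ℕ) (μ : Zd d → ℝ) (z z' : Zd d) : ℝ≥0∞ :=
  ∑' n : ℕ, stepSn d μ n z z'

/-- `hitProb z w = P_z(τ < ∞, Z(τ) = w)`, the hitting distribution on the boundary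
hyperplane, `τ = inf{t ≥ 1 : Z(t) ∈ ℤ^{d-1}×{0}}`. -/
noncomputable def hitProb (d : ℕ) (μ μ0 : Zd d → ℝ) (z w : St d) : ℝ≥0∞ :=
  if w.2 = 0 then
    ∑' n : ℕ, ∑' v : St d, stepKilledn d μ μ0 n z v * step d μ μ0 v w
  else 0

/-- The jump generating function `φ(a) = ∑_z μ(z) e^{a·z}`. -/
noncomputable def jgf (d : ℕ) (μ : Zd d → ℝ) (a : Rd d) : ℝ :=
  ∑' z : Zd d, μ z * Real.exp (dotZ d a z)

/-- Partial derivative `∂φ/∂β` of the jump generating function in the last coordinate. -/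
noncomputable def jgfDβ (d : ℕ) (μ : Zd d → ℝ) (a : Rd d) : ℝ :=
  ∑' z : Zd d, μ z * (z.2 : ℝ) * Real.exp (dotZ d a z)

/-- Gradient `∇φ(a)` of the jump generating function. -/
noncomputable def jgfGrad (d : ℕ) (μ : Zd d → ℝ) (a : Rd d) : Rd d :=
  (fun i => ∑' z : Zd d, μ z * (z.1 i : ℝ) * Real.exp (dotZ d a z), jgfDβ d μ a)

/-- The set `D = {a : φ(a) ≤ 1}`. -/
def Dset (d : ℕ) (μ : Zd d → ℝ) : Set (Rd d) := {a | jgf d μ a ≤ 1}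

/-- `∂₊D`: points of the boundary of `D` where the last coordinate of `∇φ` is `≥ 0`. -/
def bdPlus (d : ℕ) (μ : Zd d → ℝ) : Set (Rd d) :=
  {a | jgf d μ a = 1 ∧ 0 ≤ jgfDβ d μ a}

/-- `∂₋D`: points of the boundary of `D` where the last coordinate of `∇φ` is `≤ 0`. -/
def bdMinus (d : ℕ) (μ : Zd d → ℝ) : Set (Rd d) :=
  {a | jgf d μ a = 1 ∧ jgfDβ d μ a ≤ 0}

/-- `∂₀D`: points of the boundary of `D` where the last coordinate of `∇φ` is `0`. -/
def bdZero (d : ℕ) (μ : Zd d → ℝ) : Set (Rd d) :=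
  {a | jgf d μ a = 1 ∧ jgfDβ d μ a = 0}

/-- `Θ = {α ∈ ℝ^{d-1} : inf_β max(φ(α,β), φ₀(α,β)) ≤ 1}`. -/
noncomputable def Theta (d : ℕ) (μ μ0 : Zd d → ℝ) : Set (Fin (d-1) → ℝ) :=
  {α | (⨅ β : ℝ, max (jgf d μ (α, β)) (jgf d μ0 (α, β))) ≤ 1}

/-- `D̂ = (Θ×ℝ) ∩ D`. -/
noncomputable def Dhat (d : ℕ) (μ μ0 : Zd d → ℝ) : Set (Rd d) :=
  {a | a.1 ∈ Theta d μ μ0 ∧ jgf d μ a ≤ 1}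

/-- Normal cone to a convex set `s ⊆ ℝ^d` at the point `a`. -/
noncomputable def normalCone (d : ℕ) (s : Set (Rd d)) (a : Rd d) : Set (Rd d) :=
  {q | ∀ b ∈ s, dotR d q (b - a) ≤ 0}

/-- The mean vector `m = ∑_z z μ(z)`. -/
noncomputable def meanVec (d : ℕ) (μ : Zd d → ℝ) : Rd d :=
  (fun i => ∑' z : Zd d, μ z * (z.1 i : ℝ), ∑' z : Zd d, μ z * (z.2 : ℝ))

/-- The harmonic functions `h_a` of (1-8), for `a ∈ D̂ ∩ ∂₊D` with associated
point `abar = ā ∈ ∂₋D` (same first `d-1` coordinates as `a`). -/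
noncomputable def hfun (d : ℕ) (μ μ0 : Zd d → ℝ) (a abar : Rd d) (z : St d) : ℝ :=
  if jgf d μ0 abar = 1 then Real.exp (dotZ d abar (toZ d z))
  else if a = abar then
    (z.2 : ℝ) * Real.exp (dotZ d a (toZ d z))
      + (jgfDβ d μ0 a / (1 - jgf d μ0 a)) * Real.exp (dotZ d a (toZ d z))
  else
    Real.exp (dotZ d a (toZ d z))
      - ((1 - jgf d μ0 a) / (1 - jgf d μ0 abar)) * Real.exp (dotZ d abar (toZ d z))

/-- `h : ℤ^{d-1}×ℕ → ℝ` is harmonic for the reflected walk. -/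
def IsHarmonic (d : ℕ) (μ μ0 : Zd d → ℝ) (h : St d → ℝ) : Prop :=
  ∀ z : St d, HasSum (fun z' => stepR d μ μ0 z z' * h z') (h z)

/-- Minimal nonnegative harmonic function. -/
def IsMinimalHarmonic (d : ℕ) (μ μ0 : Zd d → ℝ) (h : St d → ℝ) : Prop :=
  IsHarmonic d μ μ0 h ∧ (∀ z, 0 ≤ h z) ∧ h ≠ 0 ∧
    ∀ h' : St d → ℝ, IsHarmonic d μ μ0 h' → (∀ z, 0 ≤ h' z) → h' ≠ 0 →
      (∀ z, h' z ≤ h z) → ∃ c : ℝ, 0 < c ∧ h' = fun z => c * h z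

/- Hypotheses (H0)–(H4). -/

/-- `(H0)`: `μ(x,y) = 0` for `y < -1` and `μ₀(x,y) = 0` for `y < 0`. -/
def H0 (d : ℕ) (μ μ0 : Zd d → ℝ) : Prop :=
  (∀ z : Zd d, z.2 < -1 → μ z = 0) ∧ (∀ z : Zd d, z.2 < 0 → μ0 z = 0)

/-- `(H1)`: the reflected walk is irreducible on `ℤ^{d-1}×ℕ`. -/
def H1 (d : ℕ) (μ μ0 : Zd d → ℝ) : Prop :=
  ∀ z z' : St d, ∃ n : ℕ, 0 < stepn d μ μ0 n z z'

/-- `(H2)`: the homogeneous walk with step law `μ` is irreducible on `ℤ^d` and its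
last coordinate is an aperiodic random walk on `ℤ`. -/
def H2 (d : ℕ) (μ : Zd d → ℝ) : Prop :=
  (∀ z z' : Zd d, ∃ n : ℕ, 0 < stepSn d μ n z z') ∧
    AddSubgroup.closure {y : ℤ | ∃ x : Fin (d-1) → ℤ, μ (x, y) ≠ 0} = ⊤

/-- `(H3)`: `m ≠ 0` and `m/|m| + m₀/|m₀| ≠ 0`. -/
noncomputable def H3 (d : ℕ) (μ μ0 : Zd d → ℝ) : Prop :=
  meanVec d μ ≠ 0 ∧ meanVec d μ0 ≠ 0 ∧
    ‖meanVec d μ‖⁻¹ • meanVec d μ + ‖meanVec d μ0‖⁻¹ • meanVec d μ0 ≠ 0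

/-- `(H4)`: the jump generating functions are finite everywhere on `ℝ^d`. -/
def H4 (d : ℕ) (μ μ0 : Zd d → ℝ) : Prop :=
  ∀ a : Rd d, Summable (fun z : Zd d => μ z * Real.exp (dotZ d a z)) ∧
    Summable (fun z : Zd d => μ0 z * Real.exp (dotZ d a z))

/-- `μ` is a probability distribution on `ℤ^d`. -/
def IsProb (d : ℕ) (μ : Zd d → ℝ) : Prop :=
  (∀ z : Zd d, 0 ≤ μ z) ∧ HasSum μ 1


section Kernel

variable {S : Type*} [DecidableEq S] (p : S → S → ℝ≥0∞)

lemma tsum_kerIter_zero (f : S → ℝ≥0∞) (z : S) : ∑' w, kerIter p 0 z w * f w = f z := by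
  rw [tsum_eq_single z]
  · simp [kerIter]
  · intro b hb
    simp [kerIter, hb.symm]

lemma tsum_kerIter_succ (n : ℕ) (f : S → ℝ≥0∞) (z : S) :
    ∑' w, kerIter p (n + 1) z w * f w = ∑' u, kerIter p n z u * ∑' w, p u w * f w := by
  simp only [kerIter, ← ENNReal.tsum_mul_right, ← ENNReal.tsum_mul_left]
  rw [ENNReal.tsum_comm]
  simp only [mul_assoc]

lemma kerIter_add (m n : ℕ) (z z' : S) :
    kerIter p (m + n) z z' = ∑' u, kerIter p m z u * kerIter p n u z' := by
  induction n generalizing z' with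
  | zero =>
    rw [tsum_eq_single z']
    · simp [kerIter]
    · intro b hb
      simp [kerIter, hb]
  | succ n ih =>
    rw [← add_assoc]
    simp only [kerIter, ih, ← ENNReal.tsum_mul_right, ← ENNReal.tsum_mul_left]
    rw [ENNReal.tsum_comm]
    simp only [mul_assoc]

lemma kerIter_mul_le (m n : ℕ) (z u z' : S) :
    kerIter p m z u * kerIter p n u z' ≤ kerIter p (m + n) z z' := by
  rw [kerIter_add]
  exact ENNReal.le_tsum (f := fun u => kerIter p m z u * kerIter p n u z') u

lemma kerIter_one (z z' : S) : kerIter p 1 z z' = p z z' :=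
  tsum_kerIter_zero p (fun w => p w z') z

lemma kerIter_succ_eq (n : ℕ) (z z' : S) :
    kerIter p (n + 1) z z' = ∑' u, p z u * kerIter p n u z' := by
  rw [add_comm, kerIter_add]
  simp only [kerIter_one]

lemma tsum_kerIter_le {θ : ℝ≥0∞} {f : S → ℝ≥0∞} (h : ∀ z, ∑' w, p z w * f w ≤ θ * f z)
    (n : ℕ) (z : S) : ∑' w, kerIter p n z w * f w ≤ θ ^ n * f z := by
  induction n with
  | zero => simp [tsum_kerIter_zero]
  | succ n ih =>
    rw [tsum_kerIter_succ]
    calc ∑' u, kerIter p n z u * ∑' w, p u w * f w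
        ≤ ∑' u, kerIter p n z u * (θ * f u) :=
          ENNReal.tsum_le_tsum fun u => mul_le_mul_right (h u) _
      _ = θ * ∑' u, kerIter p n z u * f u := by
          rw [← ENNReal.tsum_mul_left]
          exact tsum_congr fun u => by ring
      _ ≤ θ * (θ ^ n * f z) := mul_le_mul_right ih _
      _ = θ ^ (n + 1) * f z := by ring

lemma tsum_kerIter_eq {θ : ℝ≥0∞} {f : S → ℝ≥0∞} (h : ∀ z, ∑' w, p z w * f w = θ * f z)
    (n : ℕ) (z : S) : ∑' w, kerIter p n z w * f w = θ ^ n * f z := by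
  induction n with
  | zero => simp [tsum_kerIter_zero]
  | succ n ih =>
    rw [tsum_kerIter_succ]
    simp only [h]
    calc ∑' u, kerIter p n z u * (θ * f u) = θ * ∑' u, kerIter p n z u * f u := by
          rw [← ENNReal.tsum_mul_left]
          exact tsum_congr fun u => by ring
      _ = θ ^ (n + 1) * f z := by rw [ih]; ring

lemma kerIter_equiv {p : S → S → ℝ≥0∞} (τ : S ≃ S) (h : ∀ z w, p (τ z) (τ w) = p z w)
    (n : ℕ) (z w : S) : kerIter p n (τ z) (τ w) = kerIter p n z w := by
  induction n generalizing w with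
  | zero => simp [kerIter]
  | succ n ih =>
    simp only [kerIter]
    rw [← τ.tsum_eq]
    simp only [ih, h]

/-- `⨆ₙ pⁿ(z, z')`, a supermultiplicative lower bound for the Green's function. -/
noncomputable def reach (z z' : S) : ℝ≥0∞ := ⨆ n, kerIter p n z z'

lemma kerIter_le_reach (n : ℕ) (z z' : S) : kerIter p n z z' ≤ reach p z z' :=
  le_iSup (fun n => kerIter p n z z') n

lemma one_le_reach_self (z : S) : 1 ≤ reach p z z :=
  le_trans (by simp [kerIter]) (kerIter_le_reach p 0 z z)

lemma reach_mul_le (z u z' : S) : reach p z u * reach p u z' ≤ reach p z z' := by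
  simp only [reach, ENNReal.iSup_mul, ENNReal.mul_iSup]
  exact iSup_le fun m => iSup_le fun n =>
    (kerIter_mul_le p _ _ z u z').trans (kerIter_le_reach p _ z z')

end Kernel

section Exponentials

variable {d : ℕ}

lemma dotZ_add (a : Rd d) (z w : Zd d) : dotZ d a (z + w) = dotZ d a z + dotZ d a w := by
  simp only [dotZ, Prod.fst_add, Prod.snd_add, Pi.add_apply, Int.cast_add, mul_add,
    Finset.sum_add_distrib]
  ring

lemma dotZ_zero (a : Rd d) : dotZ d a 0 = 0 := by simp [dotZ]

lemma dotZ_add_left (a b : Rd d) (z : Zd d) : dotZ d (a + b) z = dotZ d a z + dotZ d b z := by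
  simp only [dotZ, Prod.fst_add, Prod.snd_add, Pi.add_apply, add_mul, Finset.sum_add_distrib]
  ring

lemma dotZ_smul_left (c : ℝ) (a : Rd d) (z : Zd d) : dotZ d (c • a) z = c * dotZ d a z := by
  simp only [dotZ, Prod.smul_fst, Prod.smul_snd, Pi.smul_apply, smul_eq_mul, mul_add,
    Finset.mul_sum, mul_assoc]

lemma dotR_smul_left (c : ℝ) (a q : Rd d) : dotR d (c • a) q = c * dotR d a q := by
  simp only [dotR, Prod.smul_fst, Prod.smul_snd, Pi.smul_apply, smul_eq_mul, mul_add,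
    Finset.mul_sum, mul_assoc]

lemma dotR_add_left (a b q : Rd d) : dotR d (a + b) q = dotR d a q + dotR d b q := by
  simp only [dotR, Prod.fst_add, Prod.snd_add, Pi.add_apply, add_mul, Finset.sum_add_distrib]
  ring

lemma dotR_smul_right (c : ℝ) (a q : Rd d) : dotR d a (c • q) = c * dotR d a q := by
  simp only [dotR, Prod.smul_fst, Prod.smul_snd, Pi.smul_apply, smul_eq_mul, mul_add,
    Finset.mul_sum]
  congr 1
  · exact Finset.sum_congr rfl fun i _ => by ring
  · ring

lemma dotR_toR (a : Rd d) (z : Zd d) : dotR d a (toR d z) = dotZ d a z := rfl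

lemma continuous_dotR (a : Rd d) : Continuous (dotR d a) := by
  unfold dotR
  fun_prop

/-- The exponential `z ↦ e^{a·z}`, with values in `[0, ∞]`. -/
noncomputable def ex (a : Rd d) (z : Zd d) : ℝ≥0∞ := ENNReal.ofReal (Real.exp (dotZ d a z))

lemma ex_add (a : Rd d) (z w : Zd d) : ex a (z + w) = ex a z * ex a w := by
  rw [ex, dotZ_add, Real.exp_add, ENNReal.ofReal_mul (Real.exp_pos _).le]; rfl

lemma ex_zero (a : Rd d) : ex a 0 = 1 := by simp [ex, dotZ_zero]

lemma ex_ne_zero (a : Rd d) (z : Zd d) : ex a z ≠ 0 := by simp [ex, Real.exp_pos]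

lemma ex_ne_top (a : Rd d) (z : Zd d) : ex a z ≠ ∞ := ENNReal.ofReal_ne_top

lemma ex_add_left (a b : Rd d) (z : Zd d) : ex (a + b) z = ex a z * ex b z := by
  rw [ex, dotZ_add_left, Real.exp_add, ENNReal.ofReal_mul (Real.exp_pos _).le]; rfl

lemma ex_smul (c : ℝ) (a : Rd d) (z : Zd d) : ex (c • a) z = ex a z ^ c := by
  rw [ex, dotZ_smul_left, mul_comm, Real.exp_mul, ← ENNReal.ofReal_rpow_of_pos (Real.exp_pos _)]
  rfl

/-- The jump generating function with values in `[0, ∞]`. -/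
noncomputable def mgf (ν : Zd d → ℝ) (a : Rd d) : ℝ≥0∞ := ∑' z, ENNReal.ofReal (ν z) * ex a z

lemma mgf_eq {ν : Zd d → ℝ} (hν : ∀ z, 0 ≤ ν z) {a : Rd d}
    (hs : Summable fun z : Zd d => ν z * Real.exp (dotZ d a z)) :
    mgf ν a = ENNReal.ofReal (jgf d ν a) := by
  rw [jgf, ENNReal.ofReal_tsum_of_nonneg (fun z => mul_nonneg (hν z) (Real.exp_pos _).le) hs]
  exact tsum_congr fun z => (ENNReal.ofReal_mul (hν z)).symm

lemma toZ_injective : Function.Injective (toZ d) := by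
  rintro ⟨x, y⟩ ⟨x', y'⟩ h
  simpa [toZ] using h

lemma toZ_mk_toNat {w : Zd d} (h : 0 ≤ w.2) : toZ d (w.1, w.2.toNat) = w := by
  obtain ⟨x, y⟩ := w
  simp_all [toZ]

lemma tsum_step {μ μ0 : Zd d → ℝ} (h : H0 d μ μ0) (z : St d) (g : Zd d → ℝ≥0∞) :
    ∑' w, step d μ μ0 z w * g (toZ d w) =
      if z.2 = 0 then ∑' w, ENNReal.ofReal (μ0 w) * g (toZ d z + w)
      else ∑' w, ENNReal.ofReal (μ w) * g (toZ d z + w) := by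
  have key : ∀ ν : Zd d → ℝ, (∀ w : Zd d, (toZ d z + w).2 < 0 → ν w = 0) →
      ∑' w, ENNReal.ofReal (ν (toZ d w - toZ d z)) * g (toZ d w) =
        ∑' w, ENNReal.ofReal (ν w) * g (toZ d z + w) := by
    intro ν hν
    rw [← (Equiv.addLeft (-toZ d z)).tsum_eq (fun w => ENNReal.ofReal (ν w) * g (toZ d z + w))]
    simp only [Equiv.coe_addLeft, add_neg_cancel_left]
    rw [← toZ_injective.tsum_eq (f := fun u => ENNReal.ofReal (ν (-toZ d z + u)) * g u)]
    · exact tsum_congr fun w => by rw [neg_add_eq_sub]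
    · intro u hu
      by_cases hu2 : 0 ≤ u.2
      · exact ⟨_, toZ_mk_toNat hu2⟩
      · exact absurd (by simp [hν (-toZ d z + u) (by simpa using hu2)]) hu
  unfold step
  split_ifs with hz
  · exact key μ0 fun w hw => h.2 w (by simpa [toZ, hz] using hw)
  · refine key μ fun w hw => h.1 w ?_
    have : (0 : ℤ) < z.2 := by omega
    simp only [toZ, Prod.snd_add] at hw
    omega

lemma tsum_step_ex {μ μ0 : Zd d → ℝ} (h : H0 d μ μ0) (z : St d) (a : Rd d) :
    ∑' w, step d μ μ0 z w * ex a (toZ d w) =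
      (if z.2 = 0 then mgf μ0 a else mgf μ a) * ex a (toZ d z) := by
  rw [tsum_step h]
  split_ifs
  all_goals
    rw [mgf, ← ENNReal.tsum_mul_right]
    exact tsum_congr fun w => by rw [ex_add]; ring

lemma tsum_stepS (μ : Zd d → ℝ) (z : Zd d) (g : Zd d → ℝ≥0∞) :
    ∑' w, stepS d μ z w * g w = ∑' w, ENNReal.ofReal (μ w) * g (z + w) := by
  rw [← (Equiv.addLeft (-z)).tsum_eq (fun w => ENNReal.ofReal (μ w) * g (z + w))]
  simp [stepS, neg_add_eq_sub]

lemma tsum_stepSn_ex (μ : Zd d → ℝ) (a : Rd d) (n : ℕ) (z : Zd d) :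
    ∑' w, stepSn d μ n z w * ex a w = mgf μ a ^ n * ex a z := by
  refine tsum_kerIter_eq _ (fun z => ?_) n z
  rw [tsum_stepS, mgf, ← ENNReal.tsum_mul_right]
  exact tsum_congr fun w => by rw [ex_add]; ring

lemma stepSn_add_left (μ : Zd d → ℝ) (n : ℕ) (u z w : Zd d) :
    stepSn d μ n (u + z) (u + w) = stepSn d μ n z w :=
  kerIter_equiv (Equiv.addLeft u) (fun z w => by simp [stepS]) n z w

/-- Translation of the state space along the boundary hyperplane. -/
def shift (x : Fin (d - 1) → ℤ) : St d ≃ St d := (Equiv.addLeft x).prodCongr (Equiv.refl ℕ)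

lemma shift_mk (x x' : Fin (d - 1) → ℤ) (y : ℕ) : shift x (x', y) = (x + x', y) := rfl

lemma toZ_shift (x : Fin (d - 1) → ℤ) (z : St d) :
    toZ d (shift x z) = ((x, 0) : Zd d) + toZ d z := by
  simp [shift, toZ]

lemma stepn_shift (μ μ0 : Zd d → ℝ) (n : ℕ) (x : Fin (d - 1) → ℤ) (z w : St d) :
    stepn d μ μ0 n (shift x z) (shift x w) = stepn d μ μ0 n z w := by
  refine kerIter_equiv (shift x) (fun z w => ?_) n z w
  simp only [step, toZ_shift, add_sub_add_left_eq_sub]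
  rfl

lemma green_shift (μ μ0 : Zd d → ℝ) (x : Fin (d - 1) → ℤ) (z w : St d) :
    green d μ μ0 (shift x z) (shift x w) = green d μ μ0 z w := by
  simp only [green, stepn_shift]

lemma reach_shift (μ μ0 : Zd d → ℝ) (x : Fin (d - 1) → ℤ) (z w : St d) :
    reach (step d μ μ0) (shift x z) (shift x w) = reach (step d μ μ0) z w :=
  iSup_congr fun n => stepn_shift μ μ0 n x z w

lemma reach_le_green (μ μ0 : Zd d → ℝ) (z w : St d) :
    reach (step d μ μ0) z w ≤ green d μ μ0 z w :=
  iSup_le fun n => ENNReal.le_tsum (f := fun n => stepn d μ μ0 n z w) n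

end Exponentials

section Connectivity

variable {d : ℕ} {μ μ0 : Zd d → ℝ}

lemma stepSn_eq_zero (h : H0 d μ μ0) (n : ℕ) {u v : Zd d} (huv : v.2 < u.2 - n) :
    stepSn d μ n u v = 0 := by
  induction n generalizing v with
  | zero =>
    have : u ≠ v := by rintro rfl; simp at huv
    simp [stepSn, kerIter, this]
  | succ n ih =>
    refine ENNReal.tsum_eq_zero.2 fun w => ?_
    by_cases hw : w.2 < u.2 - n
    · exact mul_eq_zero_of_left (ih hw) _
    · refine mul_eq_zero_of_right _ ?_
      simp only [stepS]
      rw [h.1 _ (by push_cast at huv; simp only [Prod.snd_sub]; omega), ENNReal.ofReal_zero]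

lemma stepSn_le_stepn (h : H0 d μ μ0) (n : ℕ) {z : St d} (hz : n ≤ z.2) (z' : St d) :
    stepSn d μ n (toZ d z) (toZ d z') ≤ stepn d μ μ0 n z z' := by
  induction n generalizing z' with
  | zero => simp [stepSn, stepn, kerIter, toZ_injective.eq_iff]
  | succ n ih =>
    have hlow : ∀ u : Zd d, u.2 < 1 → stepSn d μ n (toZ d z) u = 0 := fun u hu =>
      stepSn_eq_zero h n (by simp only [toZ]; omega)
    change ∑' u, stepSn d μ n (toZ d z) u * stepS d μ u (toZ d z') ≤
      ∑' u, stepn d μ μ0 n z u * step d μ μ0 u z'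
    rw [← toZ_injective.tsum_eq]
    · refine ENNReal.tsum_le_tsum fun u => ?_
      by_cases hu : u.2 = 0
      · rw [hlow (toZ d u) (by simp [toZ, hu]), zero_mul]
        exact zero_le
      · refine mul_le_mul' (ih (by omega) u) (le_of_eq ?_)
        simp [step, stepS, hu]
    · intro u hu
      by_cases hu2 : 0 ≤ u.2
      · exact ⟨_, toZ_mk_toNat hu2⟩
      · exact absurd (by simp [hlow u (by omega)]) hu

lemma stepSn_le_reach (h : H0 d μ μ0) (n : ℕ) {w : Zd d} {z z' : St d} (hz : n ≤ z.2)
    (hw : toZ d z' = toZ d z + w) : stepSn d μ n 0 w ≤ reach (step d μ μ0) z z' := by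
  rw [← stepSn_add_left μ n (toZ d z) 0 w, add_zero, ← hw]
  exact (stepSn_le_stepn h n hz z').trans (kerIter_le_reach _ n z z')

lemma reach_pos (h1 : H1 d μ μ0) (z z' : St d) : 0 < reach (step d μ μ0) z z' :=
  let ⟨n, hn⟩ := h1 z z'
  hn.trans_le (kerIter_le_reach _ n z z')

lemma exists_le_reach (h : H0 d μ μ0) (h1 : H1 d μ μ0) (h2 : H2 d μ) (w : Zd d) :
    ∃ δ : ℝ≥0∞, 0 < δ ∧ ∀ z z' : St d, toZ d z' = toZ d z + w →
      δ ≤ reach (step d μ μ0) z z' := by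
  obtain ⟨n, hn⟩ := h2.1 0 w
  refine ⟨min (stepSn d μ n 0 w) ((Finset.range n).inf fun y : ℕ =>
    reach (step d μ μ0) (0, y) (w.1, (y + w.2).toNat)), lt_min hn ?_, fun z z' hw => ?_⟩
  · rw [Finset.lt_inf_iff ENNReal.zero_lt_top]
    exact fun y _ => reach_pos h1 _ _
  · by_cases hz : n ≤ z.2
    · exact (min_le_left _ _).trans (stepSn_le_reach h n hz hw)
    · refine (min_le_right _ _).trans
        ((Finset.inf_le (Finset.mem_range.2 (not_le.1 hz))).trans (le_of_eq ?_))
      rw [← reach_shift μ μ0 z.1 (0, z.2)]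
      obtain ⟨x, y⟩ := z
      obtain ⟨x', y'⟩ := z'
      simp only [toZ, Prod.ext_iff, Prod.fst_add, Prod.snd_add] at hw
      simp [shift_mk, ← hw.1, ← hw.2]

lemma abs_sub_sign_le {k : ℤ} {m : ℕ} (h : |k| ≤ (m + 1 : ℕ)) : |k - k.sign| ≤ m := by
  push_cast at h
  rw [abs_le] at h ⊢
  rcases lt_trichotomy k 0 with hk | hk | hk
  · rw [Int.sign_eq_neg_one_of_neg hk]; omega
  · subst hk; simp
  · rw [Int.sign_eq_one_of_pos hk]; omega

lemma abs_sign_le (k : ℤ) : -1 ≤ k.sign ∧ k.sign ≤ 1 := by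
  rcases lt_trichotomy k 0 with hk | hk | hk
  · rw [Int.sign_eq_neg_one_of_neg hk]; omega
  · subst hk; simp
  · rw [Int.sign_eq_one_of_pos hk]; omega

lemma exists_pow_le_reach (h : H0 d μ μ0) (h1 : H1 d μ μ0) (h2 : H2 d μ) :
    ∃ δ : ℝ≥0∞, 0 < δ ∧ δ ≤ 1 ∧ ∀ (m : ℕ) (z z' : St d), (∀ i, |z'.1 i - z.1 i| ≤ m) →
      |(z'.2 : ℤ) - z.2| ≤ m → δ ^ m ≤ reach (step d μ μ0) z z' := by
  classical
  choose δ hδ hle using exists_le_reach h h1 h2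
  set δ' := min 1 ((Finset.Icc (-1 : Zd d) 1).inf δ) with hδ'
  refine ⟨δ', lt_min one_pos ?_, min_le_left _ _, fun m => ?_⟩
  · rw [Finset.lt_inf_iff ENNReal.zero_lt_top]
    exact fun w _ => hδ w
  induction m with
  | zero =>
    intro z z' hx hy
    have : z' = z := by
      refine Prod.ext (funext fun i => ?_) ?_
      · have := hx i
        simp only [Nat.cast_zero, abs_nonpos_iff] at this
        omega
      · simp only [Nat.cast_zero, abs_nonpos_iff] at hy
        omega
    rw [this, pow_zero]
    exact one_le_reach_self _ z
  | succ m ih =>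
    intro z z' hx hy
    set w : Zd d := (fun i => (z'.1 i - z.1 i).sign, ((z'.2 : ℤ) - z.2).sign) with hw
    have hw2 : 0 ≤ (toZ d z + w).2 := by
      simp only [toZ, hw, Prod.snd_add]
      rcases lt_trichotomy ((z'.2 : ℤ) - z.2) 0 with hk | hk | hk
      · rw [Int.sign_eq_neg_one_of_neg hk]; omega
      · rw [hk]; simp
      · rw [Int.sign_eq_one_of_pos hk]; omega
    set u : St d := ((toZ d z + w).1, (toZ d z + w).2.toNat) with hu
    have hzu : toZ d u = toZ d z + w := toZ_mk_toNat hw2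
    have hu1 : ∀ i, u.1 i = z.1 i + (z'.1 i - z.1 i).sign := fun i => rfl
    have hu2 : (u.2 : ℤ) = z.2 + ((z'.2 : ℤ) - z.2).sign := congrArg Prod.snd hzu
    rw [pow_succ']
    refine (mul_le_mul' ?_ (ih u z' ?_ ?_)).trans (reach_mul_le _ z u z')
    · refine ((min_le_right _ _).trans (Finset.inf_le ?_)).trans (hle w z u hzu)
      rw [Finset.mem_Icc]
      exact ⟨⟨fun i => (abs_sign_le _).1, (abs_sign_le _).1⟩,
        ⟨fun i => (abs_sign_le _).2, (abs_sign_le _).2⟩⟩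
    · intro i
      rw [hu1, ← sub_sub]
      exact abs_sub_sign_le (hx i)
    · rw [hu2, ← sub_sub]
      exact abs_sub_sign_le hy

lemma exists_exp_le_reach (h : H0 d μ μ0) (h1 : H1 d μ μ0) (h2 : H2 d μ) :
    ∃ C : ℝ, 0 ≤ C ∧ ∀ z z' : St d,
      ENNReal.ofReal (Real.exp (-(C * (‖toR d (toZ d z') - toR d (toZ d z)‖ + 1)))) ≤
        reach (step d μ μ0) z z' := by
  obtain ⟨δ, hδ, hδ1, hle⟩ := exists_pow_le_reach h h1 h2
  have htop : δ ≠ ∞ := (hδ1.trans_lt ENNReal.one_lt_top).ne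
  have hr : 0 < δ.toReal := ENNReal.toReal_pos hδ.ne' htop
  have hr1 : δ.toReal ≤ 1 := by simpa using ENNReal.toReal_mono ENNReal.one_ne_top hδ1
  have hC : 0 ≤ -Real.log δ.toReal := neg_nonneg.2 (Real.log_nonpos hr.le hr1)
  refine ⟨-Real.log δ.toReal, hC, fun z z' => ?_⟩
  set N := ‖toR d (toZ d z') - toR d (toZ d z)‖ with hN
  refine le_trans ?_ (hle ⌈N⌉₊ z z' (fun i => ?_) ?_)
  · rw [← ENNReal.ofReal_toReal htop, ← ENNReal.ofReal_pow hr.le]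
    refine ENNReal.ofReal_le_ofReal ?_
    rw [ENNReal.ofReal_toReal htop, ← Real.exp_log (pow_pos hr _), Real.log_pow]
    refine Real.exp_le_exp.2 ?_
    have := mul_le_mul_of_nonneg_left (Nat.ceil_lt_add_one (norm_nonneg
      (toR d (toZ d z') - toR d (toZ d z)))).le hC
    rw [← hN] at this
    linarith
  · have h3 : ‖(toR d (toZ d z') - toR d (toZ d z)).1 i‖ ≤ ⌈N⌉₊ :=
      ((norm_le_pi_norm _ i).trans (norm_fst_le _)).trans (Nat.le_ceil N)
    simp only [toR, toZ, Prod.fst_sub, Pi.sub_apply, Real.norm_eq_abs] at h3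
    exact_mod_cast h3
  · have h3 : ‖(toR d (toZ d z') - toR d (toZ d z)).2‖ ≤ ⌈N⌉₊ :=
      (norm_snd_le _).trans (Nat.le_ceil N)
    simp only [toR, toZ, Prod.snd_sub, Real.norm_eq_abs] at h3
    exact_mod_cast h3

end Connectivity

section GeneratingFunction

variable {d : ℕ} {μ μ0 ν : Zd d → ℝ}

lemma jgf_nonneg (hν : ∀ z, 0 ≤ ν z) (a : Rd d) : 0 ≤ jgf d ν a :=
  tsum_nonneg fun z => mul_nonneg (hν z) (Real.exp_pos _).le

lemma convexOn_jgf (hν : ∀ z, 0 ≤ ν z)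
    (hs : ∀ a, Summable fun z : Zd d => ν z * Real.exp (dotZ d a z)) :
    ConvexOn ℝ Set.univ (jgf d ν) := by
  refine ⟨convex_univ, fun a _ b _ s t hs0 ht0 hst => ?_⟩
  simp only [jgf, smul_eq_mul]
  rw [← tsum_mul_left, ← tsum_mul_left, ← ((hs a).mul_left s).tsum_add ((hs b).mul_left t)]
  refine (hs _).tsum_le_tsum (fun z => ?_) (((hs a).mul_left s).add ((hs b).mul_left t))
  have := convexOn_exp.2 (Set.mem_univ (dotZ d a z)) (Set.mem_univ (dotZ d b z)) hs0 ht0 hst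
  rw [dotZ_add_left, dotZ_smul_left, dotZ_smul_left]
  simp only [smul_eq_mul] at this
  nlinarith [mul_le_mul_of_nonneg_left this (hν z)]

lemma continuous_jgf (hν : ∀ z, 0 ≤ ν z)
    (hs : ∀ a, Summable fun z : Zd d => ν z * Real.exp (dotZ d a z)) :
    Continuous (jgf d ν) :=
  (convexOn_jgf hν hs).locallyLipschitz.continuous

lemma exp_sub_le (u : ℝ) : Real.exp u ≤ 1 + u + u * (Real.exp u - 1) := by
  have h := Real.add_one_le_exp (-u)
  have h2 : Real.exp u * Real.exp (-u) = 1 := by rw [← Real.exp_add]; simp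
  nlinarith [mul_le_mul_of_nonneg_left h (Real.exp_pos u).le]

lemma exp_mul_le {t : ℝ} (ht0 : 0 ≤ t) (ht1 : t ≤ 1) (s : ℝ) :
    Real.exp (t * s) ≤ 1 + t * s + t ^ 2 * (Real.exp (3 * s) + Real.exp (-(3 * s))) := by
  have h1 := exp_sub_le (t * s)
  have h2 : t * s * (Real.exp (t * s) - 1) ≤ (t * s) ^ 2 * Real.exp |s| := by
    rcases le_total 0 s with hs | hs
    · have h3 : Real.exp (t * s) - 1 ≤ t * s * Real.exp (t * s) := by
        have := exp_sub_le (t * s); nlinarith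
      have h4 : Real.exp (t * s) ≤ Real.exp |s| :=
        Real.exp_le_exp.2 (by rw [abs_of_nonneg hs]; nlinarith)
      have h5 : 0 ≤ t * s := mul_nonneg ht0 hs
      calc t * s * (Real.exp (t * s) - 1) ≤ t * s * (t * s * Real.exp (t * s)) :=
            mul_le_mul_of_nonneg_left h3 h5
        _ = (t * s) ^ 2 * Real.exp (t * s) := by ring
        _ ≤ _ := mul_le_mul_of_nonneg_left h4 (sq_nonneg _)
    · have h3 := Real.add_one_le_exp (t * s)
      have h5 : t * s ≤ 0 := mul_nonpos_of_nonneg_of_nonpos ht0 hs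
      have h6 : 1 ≤ Real.exp |s| := Real.one_le_exp (abs_nonneg s)
      nlinarith [sq_nonneg (t * s)]
  have h3 : s ^ 2 ≤ Real.exp (2 * |s|) := by
    have h4 : |s| ≤ Real.exp |s| := by linarith [Real.add_one_le_exp |s|]
    rw [two_mul, Real.exp_add, ← sq_abs, sq]
    exact mul_le_mul h4 h4 (abs_nonneg s) (Real.exp_pos _).le
  have h4 : s ^ 2 * Real.exp |s| ≤ Real.exp (3 * |s|) := by
    have : (3 : ℝ) * |s| = 2 * |s| + |s| := by ring
    rw [this, Real.exp_add]
    exact mul_le_mul_of_nonneg_right h3 (Real.exp_pos _).le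
  have h5 : Real.exp (3 * |s|) ≤ Real.exp (3 * s) + Real.exp (-(3 * s)) := by
    rcases abs_choice s with h | h <;> rw [h]
    · linarith [Real.exp_pos (-(3 * s))]
    · rw [mul_neg]; linarith [Real.exp_pos (3 * s)]
  have h6 : (t * s) ^ 2 * Real.exp |s| ≤ t ^ 2 * (Real.exp (3 * s) + Real.exp (-(3 * s))) := by
    calc (t * s) ^ 2 * Real.exp |s| = t ^ 2 * (s ^ 2 * Real.exp |s|) := by ring
      _ ≤ _ := mul_le_mul_of_nonneg_left (h4.trans h5) (sq_nonneg t)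
  linarith

lemma summable_mul_dotZ (hν : ∀ z, 0 ≤ ν z)
    (hs : ∀ a, Summable fun z : Zd d => ν z * Real.exp (dotZ d a z)) (a : Rd d) :
    Summable fun z : Zd d => ν z * dotZ d a z := by
  refine Summable.of_norm_bounded ((hs a).add (hs (-1 • a : Rd d))) fun z => ?_
  rw [norm_mul, Real.norm_of_nonneg (hν z), ← mul_add]
  refine mul_le_mul_of_nonneg_left ?_ (hν z)
  have h1 := Real.add_one_le_exp (dotZ d a z)
  have h2 := Real.add_one_le_exp (-dotZ d a z)
  have h3 : dotZ d (-1 • a : Rd d) z = -dotZ d a z := by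
    have := dotZ_smul_left (-1) a z
    simpa using this
  rw [h3, Real.norm_eq_abs]
  rcases abs_choice (dotZ d a z) with h | h <;> rw [h]
  · linarith [Real.exp_pos (-dotZ d a z)]
  · linarith [Real.exp_pos (dotZ d a z)]

lemma dotR_meanVec (hν : ∀ z, 0 ≤ ν z)
    (hs : ∀ a, Summable fun z : Zd d => ν z * Real.exp (dotZ d a z)) (a : Rd d) :
    dotR d a (meanVec d ν) = ∑' z : Zd d, ν z * dotZ d a z := by
  have h1 : ∀ i, Summable fun z : Zd d => ν z * (z.1 i : ℝ) := fun i => by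
    have := summable_mul_dotZ hν hs ((Pi.single i 1, 0) : Rd d)
    simpa [dotZ, Pi.single_apply] using this
  have h2 : Summable fun z : Zd d => ν z * (z.2 : ℝ) := by
    have := summable_mul_dotZ hν hs ((0, 1) : Rd d)
    simpa [dotZ] using this
  have h3 : ∀ z : Zd d, ν z * dotZ d a z =
      (∑ i, a.1 i * (ν z * (z.1 i : ℝ))) + a.2 * (ν z * (z.2 : ℝ)) := fun z => by
    rw [dotZ, mul_add, Finset.mul_sum]
    congr 1
    · exact Finset.sum_congr rfl fun i _ => by ring
    · ring
  simp only [h3]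
  rw [Summable.tsum_add (summable_sum fun i _ => (h1 i).mul_left _) (h2.mul_left _),
    Summable.tsum_finsetSum fun i _ => (h1 i).mul_left _, tsum_mul_left]
  simp only [tsum_mul_left]
  rfl

lemma jgf_smul_le (hν : IsProb d ν)
    (hs : ∀ a, Summable fun z : Zd d => ν z * Real.exp (dotZ d a z)) (v : Rd d) {t : ℝ}
    (ht0 : 0 ≤ t) (ht1 : t ≤ 1) :
    jgf d ν (t • v) ≤ 1 + t * dotR d v (meanVec d ν) +
      t ^ 2 * (jgf d ν ((3 : ℝ) • v) + jgf d ν ((-3 : ℝ) • v)) := by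
  have h1 := summable_mul_dotZ hν.1 hs v
  have h2 := ((hν.2.summable.add (h1.mul_left t)).add
    (((hs ((3 : ℝ) • v)).add (hs ((-3 : ℝ) • v))).mul_left (t ^ 2)))
  have h3 : jgf d ν (t • v) ≤ ∑' z : Zd d, (ν z + t * (ν z * dotZ d v z) +
      t ^ 2 * (ν z * Real.exp (dotZ d ((3 : ℝ) • v) z) +
        ν z * Real.exp (dotZ d ((-3 : ℝ) • v) z))) := by
    refine (hs _).tsum_le_tsum (fun z => ?_) h2
    rw [dotZ_smul_left, dotZ_smul_left, dotZ_smul_left, neg_mul]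
    have := mul_le_mul_of_nonneg_left (exp_mul_le ht0 ht1 (dotZ d v z)) (hν.1 z)
    refine this.trans (le_of_eq ?_)
    ring
  refine h3.trans (le_of_eq ?_)
  rw [Summable.tsum_add (hν.2.summable.add (h1.mul_left t))
    (((hs ((3 : ℝ) • v)).add (hs ((-3 : ℝ) • v))).mul_left (t ^ 2)),
    Summable.tsum_add hν.2.summable (h1.mul_left t), tsum_mul_left, tsum_mul_left,
    Summable.tsum_add (hs _) (hs _), hν.2.tsum_eq, dotR_meanVec hν.1 hs]
  rfl

lemma eventually_jgf_lt_one (hν : IsProb d ν)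
    (hs : ∀ a, Summable fun z : Zd d => ν z * Real.exp (dotZ d a z)) {v : Rd d}
    (hv : dotR d v (meanVec d ν) < 0) :
    ∀ᶠ t in nhdsWithin (0 : ℝ) (Set.Ioi 0), jgf d ν (t • v) < 1 := by
  set B := jgf d ν ((3 : ℝ) • v) + jgf d ν ((-3 : ℝ) • v)
  have h1 : Tendsto (fun t : ℝ => dotR d v (meanVec d ν) + t * B)
      (nhdsWithin (0 : ℝ) (Set.Ioi 0)) (nhds (dotR d v (meanVec d ν) + 0 * B)) :=
    Tendsto.mono_left (Continuous.tendsto (by fun_prop) 0) nhdsWithin_le_nhds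
  have h2 := h1.eventually_lt_const (u := 0) (by simpa using hv)
  filter_upwards [h2, Ioc_mem_nhdsGT (zero_lt_one' ℝ)] with t ht ht1
  have h3 := jgf_smul_le hν hs v ht1.1.le ht1.2
  have h4 : t * (dotR d v (meanVec d ν) + t * B) < 0 := mul_neg_of_pos_of_neg ht1.1 ht
  calc jgf d ν (t • v) ≤ _ := h3
    _ = 1 + t * (dotR d v (meanVec d ν) + t * B) := by ring
    _ < 1 := by linarith

lemma dotR_comm (a b : Rd d) : dotR d a b = dotR d b a := by
  simp only [dotR, mul_comm]

lemma dotR_self_nonneg (a : Rd d) : 0 ≤ dotR d a a :=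
  add_nonneg (Finset.sum_nonneg fun _ _ => mul_self_nonneg _) (mul_self_nonneg _)

lemma dotR_self_eq_zero {a : Rd d} (h : dotR d a a = 0) : a = 0 := by
  have h1 : 0 ≤ ∑ i, a.1 i * a.1 i := Finset.sum_nonneg fun _ _ => mul_self_nonneg _
  have h2 := mul_self_nonneg a.2
  unfold dotR at h
  have h3 : ∑ i, a.1 i * a.1 i = 0 := by linarith
  have h4 : a.2 * a.2 = 0 := by linarith
  rw [Finset.sum_eq_zero_iff_of_nonneg fun _ _ => mul_self_nonneg _] at h3
  exact Prod.ext (funext fun i => mul_self_eq_zero.1 (h3 i (Finset.mem_univ i)))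
    (mul_self_eq_zero.1 h4)

lemma exists_dotR_neg {m m0 : Rd d} (hm : m ≠ 0) (hm0 : m0 ≠ 0)
    (h : ‖m‖⁻¹ • m + ‖m0‖⁻¹ • m0 ≠ 0) : ∃ v, dotR d v m < 0 ∧ dotR d v m0 < 0 := by
  have hpos : ∀ m : Rd d, m ≠ 0 → 0 < dotR d m m := fun m hm =>
    lt_of_le_of_ne (dotR_self_nonneg m) fun h => hm (dotR_self_eq_zero h.symm)
  set N := √(dotR d m m) with hN
  set N0 := √(dotR d m0 m0) with hN0
  have hN1 : 0 < N := Real.sqrt_pos.2 (hpos m hm)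
  have hN01 : 0 < N0 := Real.sqrt_pos.2 (hpos m0 hm0)
  have hN2 : N * N = dotR d m m := Real.mul_self_sqrt (dotR_self_nonneg m)
  have hN02 : N0 * N0 = dotR d m0 m0 := Real.mul_self_sqrt (dotR_self_nonneg m0)
  have hne : N0 • m + N • m0 ≠ 0 := by
    intro h0
    have h1 : m = (-(N / N0)) • m0 := by
      have h2 : N0 • m = -(N • m0) := eq_neg_of_add_eq_zero_left h0
      have h3 : m = N0⁻¹ • (N0 • m) := by rw [smul_smul, inv_mul_cancel₀ hN01.ne', one_smul]
      rw [h3, h2, ← neg_smul, smul_smul]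
      congr 1
      field_simp
    apply h
    have h4 : ‖m‖ = N / N0 * ‖m0‖ := by
      rw [h1, norm_smul, norm_neg, Real.norm_of_nonneg (div_pos hN1 hN01).le]
    rw [h4, h1, smul_smul, ← add_smul]
    have h5 : ‖m0‖ ≠ 0 := norm_ne_zero_iff.2 hm0
    have : (N / N0 * ‖m0‖)⁻¹ * -(N / N0) + ‖m0‖⁻¹ = 0 := by
      field_simp
      ring
    rw [this, zero_smul]
  have hexp := hpos _ hne
  have hc := dotR_comm m0 m
  have hexpand : ∀ w, dotR d (N0 • m + N • m0) w = N0 * dotR d m w + N * dotR d m0 w :=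
    fun w => by rw [dotR_add_left, dotR_smul_left, dotR_smul_left]
  rw [hexpand, dotR_comm m, dotR_comm m0, hexpand, hexpand, hc, ← hN2, ← hN02] at hexp
  have hgen : 0 < N * N0 + dotR d m m0 := by
    have h1 : 0 < (2 * (N * N0)) * (N * N0 + dotR d m m0) := by linarith
    exact (mul_pos_iff_of_pos_left (by positivity)).1 h1
  refine ⟨(-1 : ℝ) • (N0 • m + N • m0), ?_, ?_⟩
  · rw [dotR_smul_left, hexpand, hc, ← hN2]
    linarith [mul_pos hN1 hgen]
  · rw [dotR_smul_left, hexpand, ← hN02]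
    linarith [mul_pos hN01 hgen]

end GeneratingFunction

section UpperBound

variable {d : ℕ} {μ μ0 : Zd d → ℝ}

lemma exists_ball_jgf_le (hμ : IsProb d μ) (hμ0 : IsProb d μ0) (h3 : H3 d μ μ0)
    (h4 : H4 d μ μ0) :
    ∃ (b : Rd d) (η θ : ℝ), 0 < η ∧ θ < 1 ∧
      ∀ a, ‖a - b‖ ≤ η → jgf d μ a ≤ θ ∧ jgf d μ0 a ≤ θ := by
  obtain ⟨v, hv, hv0⟩ := exists_dotR_neg h3.1 h3.2.1 h3.2.2
  obtain ⟨t, ht, ht0⟩ := ((eventually_jgf_lt_one hμ (fun a => (h4 a).1) hv).and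
    (eventually_jgf_lt_one hμ0 (fun a => (h4 a).2) hv0)).exists
  obtain ⟨θ, hθ, hθ1⟩ := exists_between (max_lt ht ht0)
  have h5 : ∀ᶠ a in nhds (t • v), jgf d μ a < θ ∧ jgf d μ0 a < θ :=
    ((continuous_jgf hμ.1 fun a => (h4 a).1).continuousAt.eventually_lt_const
      ((le_max_left _ _).trans_lt hθ)).and
    ((continuous_jgf hμ0.1 fun a => (h4 a).2).continuousAt.eventually_lt_const
      ((le_max_right _ _).trans_lt hθ))
  obtain ⟨η, hη, h6⟩ := Metric.nhds_basis_closedBall.eventually_iff.1 h5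
  refine ⟨t • v, η, θ, hη, hθ1, fun a ha => ?_⟩
  have := h6 (mem_closedBall_iff_norm.2 ha)
  exact ⟨this.1.le, this.2.le⟩

lemma stepn_mul_ex_le (hμ : IsProb d μ) (hμ0 : IsProb d μ0) (h : H0 d μ μ0) (h4 : H4 d μ μ0)
    {a : Rd d} {θ : ℝ} (ha : jgf d μ a ≤ θ) (ha0 : jgf d μ0 a ≤ θ) (n : ℕ) (z z' : St d) :
    stepn d μ μ0 n z z' * ex a (toZ d z') ≤ ENNReal.ofReal θ ^ n * ex a (toZ d z) := by
  refine (ENNReal.le_tsum (f := fun w => stepn d μ μ0 n z w * ex a (toZ d w)) z').trans ?_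
  refine tsum_kerIter_le (step d μ μ0) (f := fun w => ex a (toZ d w)) (fun z => ?_) n z
  rw [tsum_step_ex h]
  refine mul_le_mul_left ?_ _
  split_ifs
  · rw [mgf_eq hμ0.1 (h4 a).2]
    exact ENNReal.ofReal_le_ofReal ha0
  · rw [mgf_eq hμ.1 (h4 a).1]
    exact ENNReal.ofReal_le_ofReal ha

lemma green_mul_ex_le (hμ : IsProb d μ) (hμ0 : IsProb d μ0) (h : H0 d μ μ0) (h4 : H4 d μ μ0)
    {a a' : Rd d} (haa : a.1 = a'.1) (ha : jgf d μ a < 1) (ha' : jgf d μ a' < 1)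
    (ha0 : jgf d μ0 a' < 1) (z : St d) :
    ∃ B : ℝ≥0∞, B ≠ ∞ ∧ ∀ z', green d μ μ0 z z' * ex a (toZ d z') ≤ B := by
  obtain ⟨θ, hθ, hθ1⟩ := exists_between (max_lt (max_lt ha ha') ha0)
  simp only [max_lt_iff] at hθ
  obtain ⟨⟨hθa, hθa'⟩, hθ0⟩ := hθ
  have hK0 : 0 ≤ jgf d μ0 a / (θ - jgf d μ0 a') :=
    div_nonneg (jgf_nonneg hμ0.1 a) (by linarith)
  have hθnn : 0 ≤ θ := (jgf_nonneg hμ0.1 a').trans hθ0.le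
  set K := jgf d μ0 a / (θ - jgf d μ0 a') with hK
  have hKeq : K * (θ - jgf d μ0 a') = jgf d μ0 a := div_mul_cancel₀ _ (by linarith)
  set f : St d → ℝ≥0∞ := fun w => ex a (toZ d w) + ENNReal.ofReal K * ex a' (toZ d w) with hf
  have hsup : ∀ w, ∑' u, step d μ μ0 w u * f u ≤ ENNReal.ofReal θ * f w := by
    intro w
    have hsum : ∑' u, step d μ μ0 w u * f u =
        (if w.2 = 0 then mgf μ0 a else mgf μ a) * ex a (toZ d w) +
        ENNReal.ofReal K * ((if w.2 = 0 then mgf μ0 a' else mgf μ a') * ex a' (toZ d w)) := by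
      rw [← tsum_step_ex h, ← tsum_step_ex h, ← ENNReal.tsum_mul_left, ← ENNReal.tsum_add]
      exact tsum_congr fun u => by simp only [hf]; ring
    rw [hsum]
    simp only [hf]
    rw [mgf_eq hμ0.1 (h4 a).2, mgf_eq hμ.1 (h4 a).1, mgf_eq hμ0.1 (h4 a').2,
      mgf_eq hμ.1 (h4 a').1]
    split_ifs with hw
    · have he : ex a' (toZ d w) = ex a (toZ d w) := by
        simp [ex, dotZ, haa, toZ, hw]
      rw [he, ← mul_assoc, ← add_mul, ← one_add_mul, ← mul_assoc]
      refine mul_le_mul_left ?_ _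
      rw [← ENNReal.ofReal_mul hK0, ← ENNReal.ofReal_add (jgf_nonneg hμ0.1 a)
        (mul_nonneg hK0 (jgf_nonneg hμ0.1 a')), ← ENNReal.ofReal_one,
        ← ENNReal.ofReal_add zero_le_one hK0, ← ENNReal.ofReal_mul hθnn]
      exact ENNReal.ofReal_le_ofReal (by nlinarith)
    · rw [mul_add]
      refine add_le_add (mul_le_mul_left (ENNReal.ofReal_le_ofReal hθa.le) _) ?_
      rw [mul_left_comm (ENNReal.ofReal θ)]
      exact mul_le_mul_right (mul_le_mul_left (ENNReal.ofReal_le_ofReal hθa'.le) _) _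
  refine ⟨(1 - ENNReal.ofReal θ)⁻¹ * f z, ENNReal.mul_ne_top ?_ ?_, fun z' => ?_⟩
  · rw [ENNReal.inv_ne_top]
    exact (tsub_pos_of_lt (ENNReal.ofReal_lt_one.2 hθ1)).ne'
  · exact ENNReal.add_ne_top.2 ⟨ex_ne_top _ _,
      ENNReal.mul_ne_top ENNReal.ofReal_ne_top (ex_ne_top _ _)⟩
  · calc green d μ μ0 z z' * ex a (toZ d z') ≤ green d μ μ0 z z' * f z' :=
          mul_le_mul_right le_self_add _
      _ = ∑' n, stepn d μ μ0 n z z' * f z' := by rw [green, ENNReal.tsum_mul_right]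
      _ ≤ ∑' n, ENNReal.ofReal θ ^ n * f z := ENNReal.tsum_le_tsum fun n =>
          (ENNReal.le_tsum (f := fun w => stepn d μ μ0 n z w * f w) z').trans
            (tsum_kerIter_le _ hsup n z)
      _ = (1 - ENNReal.ofReal θ)⁻¹ * f z := by rw [ENNReal.tsum_mul_right, ENNReal.tsum_geometric]

lemma convexComb_lt_one {x y t κ θ : ℝ} (ht0 : 0 < t) (ht1 : t ≤ 1) (hx : x ≤ 1 + κ)
    (hy : y ≤ θ) (hκ0 : 0 ≤ κ) (hκ : κ < t * (1 - θ)) : (1 - t) * x + t * y < 1 := by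
  nlinarith [mul_le_mul_of_nonneg_left hx (sub_nonneg.2 ht1),
    mul_le_mul_of_nonneg_left hy ht0.le]

/-- Exponential upper bound for the Green's function at interior points of `D̂`. -/
lemma exists_green_mul_ex_le (hμ : IsProb d μ) (hμ0 : IsProb d μ0) (h : H0 d μ μ0)
    (h4 : H4 d μ μ0) {a b : Rd d} {θ t : ℝ} (hθ : θ < 1) (hb : jgf d μ b ≤ θ)
    (hb0 : jgf d μ0 b ≤ θ) (ha : a ∈ Dhat d μ μ0) (ht0 : 0 < t) (ht1 : t ≤ 1) (z : St d) :
    ∃ B : ℝ≥0∞, B ≠ ∞ ∧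
      ∀ z', green d μ μ0 z z' * ex ((1 - t) • a + t • b) (toZ d z') ≤ B := by
  obtain ⟨α, β⟩ := a
  obtain ⟨hα, hD⟩ := ha
  have hκ : 0 < t * (1 - θ) / 2 := by have : 0 < 1 - θ := by linarith
                                      positivity
  obtain ⟨β', hβ'⟩ := exists_lt_of_ciInf_lt (lt_of_le_of_lt hα (lt_add_of_pos_right 1 hκ))
  rw [max_lt_iff] at hβ'
  have hcx := fun x y : Rd d => (convexOn_jgf hμ.1 fun a => (h4 a).1).2
    (Set.mem_univ x) (Set.mem_univ y) (sub_nonneg.2 ht1) ht0.le (sub_add_cancel 1 t)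
  have hcx0 := fun x y : Rd d => (convexOn_jgf hμ0.1 fun a => (h4 a).2).2
    (Set.mem_univ x) (Set.mem_univ y) (sub_nonneg.2 ht1) ht0.le (sub_add_cancel 1 t)
  have hlt : t * (1 - θ) / 2 < t * (1 - θ) := by linarith
  refine green_mul_ex_le hμ hμ0 h h4 (a := (1 - t) • (α, β) + t • b)
    (a' := (1 - t) • (α, β') + t • b) rfl
    ((hcx _ _).trans_lt ?_) ((hcx _ _).trans_lt ?_) ((hcx0 _ _).trans_lt ?_) z
  · exact convexComb_lt_one ht0 ht1 (hD.trans (by linarith)) hb hκ.le hlt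
  · exact convexComb_lt_one ht0 ht1 hβ'.1.le hb hκ.le hlt
  · exact convexComb_lt_one ht0 ht1 hβ'.2.le hb0 hκ.le hlt

end UpperBound

section Weights

variable {d : ℕ} {μ μ0 : Zd d → ℝ}

lemma exists_dotZ_le (hμ : IsProb d μ) (h2 : H2 d μ) (h4 : H4 d μ μ0) (w : Zd d) :
    ∃ M : ℝ, ∀ a, jgf d μ a ≤ 1 → dotZ d a w ≤ M := by
  obtain ⟨n, hn⟩ := h2.1 0 w
  have key : ∀ a, jgf d μ a ≤ 1 → stepSn d μ n 0 w * ex a w ≤ 1 := by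
    intro a ha
    refine (ENNReal.le_tsum (f := fun w => stepSn d μ n 0 w * ex a w) w).trans ?_
    rw [tsum_stepSn_ex, ex_zero, mul_one, mgf_eq hμ.1 (h4 a).1]
    exact pow_le_one₀ zero_le (ENNReal.ofReal_le_one.2 ha)
  set p := stepSn d μ n 0 w
  have hp : p ≠ ∞ := by
    rintro hp
    by_cases h0 : ∃ a, jgf d μ a ≤ 1
    · obtain ⟨a, ha⟩ := h0
      have := key a ha
      rw [hp, ENNReal.top_mul (ex_ne_zero _ _)] at this
      simp at this
    · have := hμ.2.tsum_eq
      exact h0 ⟨0, by simp [jgf, dotZ, this]⟩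
  refine ⟨-Real.log p.toReal, fun a ha => ?_⟩
  have h3 := key a ha
  have hp0 : 0 < p.toReal := ENNReal.toReal_pos hn.ne' hp
  have h5 : p.toReal * Real.exp (dotZ d a w) ≤ 1 := by
    have := ENNReal.toReal_mono ENNReal.one_ne_top h3
    rwa [ENNReal.toReal_mul, ex, ENNReal.toReal_ofReal (Real.exp_pos _).le,
      ENNReal.toReal_one] at this
  have h6 := Real.log_le_log (by positivity) h5
  rw [Real.log_mul hp0.ne' (Real.exp_pos _).ne', Real.log_exp, Real.log_one] at h6
  linarith

lemma mul_le_of_bounds {x q M M' : ℝ} (h : x ≤ M) (h' : -x ≤ M') : x * q ≤ (|M| + |M'|) * |q| := by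
  refine (le_abs_self _).trans ?_
  rw [abs_mul]
  refine mul_le_mul_of_nonneg_right ?_ (abs_nonneg q)
  rw [abs_le]
  constructor <;> linarith [le_abs_self M, le_abs_self M', abs_nonneg M, abs_nonneg M']

lemma bddAbove_dotR (hμ : IsProb d μ) (h2 : H2 d μ) (h4 : H4 d μ μ0) (q : Rd d) :
    BddAbove (Set.range fun a : Dhat d μ μ0 => dotR d (a : Rd d) q) := by
  choose M hM using exists_dotZ_le (μ0 := μ0) hμ h2 h4
  refine ⟨(∑ i, (|M (Pi.single i 1, 0)| + |M (Pi.single i (-1), 0)|) * |q.1 i|) +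
    (|M (0, 1)| + |M (0, -1)|) * |q.2|, ?_⟩
  rintro _ ⟨⟨a, -, ha⟩, rfl⟩
  refine add_le_add (Finset.sum_le_sum fun i _ => mul_le_of_bounds ?_ ?_) (mul_le_of_bounds ?_ ?_)
  · simpa [dotZ, Pi.single_apply] using hM (Pi.single i 1, 0) a ha
  · simpa [dotZ, Pi.single_apply, apply_ite] using hM (Pi.single i (-1), 0) a ha
  · simpa [dotZ] using hM (0, 1) a ha
  · simpa [dotZ] using hM (0, -1) a ha

lemma mem_Theta_of (hμ : IsProb d μ) {α : Fin (d - 1) → ℝ} {β : ℝ}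
    (h : jgf d μ (α, β) ≤ 1) (h0 : jgf d μ0 (α, β) ≤ 1) : α ∈ Theta d μ μ0 :=
  le_trans (ciInf_le (f := fun β => max (jgf d μ (α, β)) (jgf d μ0 (α, β)))
    ⟨0, by rintro _ ⟨x, rfl⟩; exact le_max_of_le_left (jgf_nonneg hμ.1 _)⟩ β) (max_le h h0)

lemma jgf_zero (hμ : IsProb d μ) : jgf d μ 0 = 1 := by
  simp [jgf, dotZ, hμ.2.tsum_eq]

lemma zero_mem_Dhat (hμ : IsProb d μ) (hμ0 : IsProb d μ0) : (0 : Rd d) ∈ Dhat d μ μ0 :=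
  ⟨mem_Theta_of (β := 0) hμ (jgf_zero hμ).le (jgf_zero hμ0).le, (jgf_zero hμ).le⟩

/-- The product weight `∏ e^{-c|w_i|}` on `ℤ^d`. -/
noncomputable def wt (c : ℝ) (w : Zd d) : ℝ≥0∞ :=
  ENNReal.ofReal (Real.exp (-(c * ((∑ i, |(w.1 i : ℝ)|) + |(w.2 : ℝ)|))))

lemma tsum_pi_prod (g : ℤ → ℝ≥0∞) (k : ℕ) :
    ∑' x : Fin k → ℤ, ∏ i, g (x i) = (∑' n, g n) ^ k := by
  induction k with
  | zero => simp
  | succ k ih =>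
    rw [← (Fin.insertNthEquiv (fun _ => ℤ) 0).tsum_eq, ENNReal.tsum_prod', pow_succ', ← ih,
      ← ENNReal.tsum_mul_right]
    refine tsum_congr fun n => ?_
    rw [← ENNReal.tsum_mul_left]
    refine tsum_congr fun x => ?_
    rw [Fin.prod_univ_succ]
    simp [Fin.insertNthEquiv]

lemma tsum_exp_abs_ne_top {c : ℝ} (hc : 0 < c) :
    ∑' n : ℤ, ENNReal.ofReal (Real.exp (-(c * |(n : ℝ)|))) ≠ ∞ := by
  have h : Summable fun n : ℕ => Real.exp (-(c * n)) := by
    have := Real.summable_exp_nat_mul_iff.2 (neg_lt_zero.2 hc)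
    refine this.congr fun n => by ring_nf
  have : Summable fun n : ℤ => Real.exp (-(c * |(n : ℝ)|)) := by
    refine Summable.of_nat_of_neg (h.congr fun n => ?_) (h.congr fun n => ?_) <;> simp
  exact this.tsum_ofReal_ne_top

lemma tsum_wt_ne_top {c : ℝ} (hc : 0 < c) : ∑' w : Zd d, wt c w ≠ ∞ := by
  have h : ∀ w : Zd d, wt c w = (∏ i, ENNReal.ofReal (Real.exp (-(c * |(w.1 i : ℝ)|)))) *
      ENNReal.ofReal (Real.exp (-(c * |(w.2 : ℝ)|))) := fun w => by
    rw [← ENNReal.ofReal_prod_of_nonneg fun _ _ => (Real.exp_pos _).le, ← Real.exp_sum,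
      ← ENNReal.ofReal_mul (Real.exp_pos _).le, ← Real.exp_add, wt, Finset.sum_neg_distrib,
      ← Finset.mul_sum]
    congr 2
    ring
  simp only [h]
  rw [ENNReal.tsum_prod']
  simp only [ENNReal.tsum_mul_left, ENNReal.tsum_mul_right]
  rw [tsum_pi_prod (fun n => ENNReal.ofReal (Real.exp (-(c * |(n : ℝ)|))))]
  exact ENNReal.mul_ne_top (ENNReal.pow_ne_top (tsum_exp_abs_ne_top hc)) (tsum_exp_abs_ne_top hc)

lemma tsum_wt_boundary_ne_top {c : ℝ} (hc : 0 < c) :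
    ∑' x : Fin (d - 1) → ℤ, wt c ((x, 0) : Zd d) ≠ ∞ :=
  ne_top_of_le_ne_top (tsum_wt_ne_top hc)
    (ENNReal.tsum_comp_le_tsum_of_injective (f := fun x => ((x, 0) : Zd d))
      (fun x y h => by simpa using h) (wt c))

end Weights

section BoundaryPotential

variable {d : ℕ} {μ μ0 : Zd d → ℝ}

/-- The Green potential of the boundary weighted by `e^{α·x}`. -/
noncomputable def bdPot (d : ℕ) (μ μ0 : Zd d → ℝ) (α : Fin (d - 1) → ℝ) (z : St d) : ℝ≥0∞ :=
  ∑' x : Fin (d - 1) → ℤ, green d μ μ0 z (x, 0) * ex ((α, 0) : Rd d) (x, 0)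

lemma tsum_step_bdPot_le (α : Fin (d - 1) → ℝ) (z : St d) :
    ∑' w, step d μ μ0 z w * bdPot d μ μ0 α w ≤ bdPot d μ μ0 α z := by
  simp only [bdPot, ← ENNReal.tsum_mul_left]
  rw [ENNReal.tsum_comm]
  refine ENNReal.tsum_le_tsum fun x => ?_
  simp only [← mul_assoc]
  rw [ENNReal.tsum_mul_right]
  refine mul_le_mul_left ?_ _
  simp only [green, ← ENNReal.tsum_mul_left]
  rw [ENNReal.tsum_comm]
  simp only [stepn, ← kerIter_succ_eq]
  exact ENNReal.tsum_comp_le_tsum_of_injective (add_left_injective 1)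
    (fun n => kerIter (step d μ μ0) n z (x, 0))

lemma reach_mul_bdPot_le (α : Fin (d - 1) → ℝ) (z u : St d) :
    reach (step d μ μ0) z u * bdPot d μ μ0 α u ≤ bdPot d μ μ0 α z := by
  rw [reach, ENNReal.iSup_mul]
  refine iSup_le fun n => ?_
  refine (ENNReal.le_tsum
    (f := fun u => kerIter (step d μ μ0) n z u * bdPot d μ μ0 α u) u).trans ?_
  simpa using tsum_kerIter_le (step d μ μ0) (θ := 1) (f := bdPot d μ μ0 α)
    (fun z => by simpa using tsum_step_bdPot_le α z) n z

lemma bdPot_shift (α : Fin (d - 1) → ℝ) (x : Fin (d - 1) → ℤ) (z : St d) :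
    bdPot d μ μ0 α (shift x z) = ex ((α, 0) : Rd d) (x, 0) * bdPot d μ μ0 α z := by
  rw [bdPot, ← (Equiv.addLeft x).tsum_eq, bdPot, ← ENNReal.tsum_mul_left]
  refine tsum_congr fun x' => ?_
  have h1 : (((Equiv.addLeft x) x', 0) : St d) = shift x (x', 0) := rfl
  have h2 : (((Equiv.addLeft x) x', 0) : Zd d) = (x, 0) + (x', 0) := by simp
  rw [h1, h2, green_shift, ex_add]
  ring

lemma bdPot_eq (α : Fin (d - 1) → ℝ) (z : St d) :
    bdPot d μ μ0 α z = ex ((α, 0) : Rd d) (toZ d z) * bdPot d μ μ0 α (0, z.2) := by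
  have h : z = shift z.1 (0, z.2) := by simp [shift_mk]
  conv_lhs => rw [h]
  rw [bdPot_shift]
  congr 1
  simp [ex, dotZ, toZ]

lemma ex_neg_log {S : ℝ≥0∞} (hS0 : S ≠ 0) (hS : S ≠ ∞) (α : Fin (d - 1) → ℝ) (w : Zd d) (j : ℕ) :
    (w.2 = j → ex ((α, -Real.log S.toReal) : Rd d) w * S ^ j = ex ((α, 0) : Rd d) w) ∧
    (w.2 = -1 → ex ((α, -Real.log S.toReal) : Rd d) w = ex ((α, 0) : Rd d) w * S) := by
  have hr : 0 < S.toReal := ENNReal.toReal_pos hS0 hS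
  have hsplit : ex ((α, -Real.log S.toReal) : Rd d) w = ex ((α, 0) : Rd d) w *
      ENNReal.ofReal (Real.exp (-Real.log S.toReal * w.2)) := by
    rw [ex, ex, ← ENNReal.ofReal_mul (Real.exp_pos _).le, ← Real.exp_add]
    simp [dotZ]
  refine ⟨fun h => ?_, fun h => ?_⟩
  · rw [hsplit, mul_assoc, ← ENNReal.ofReal_toReal hS, ← ENNReal.ofReal_pow hr.le,
      ENNReal.toReal_ofReal hr.le, ← ENNReal.ofReal_mul (Real.exp_pos _).le, h]
    have : Real.exp (-Real.log S.toReal * ((j : ℤ) : ℝ)) * S.toReal ^ j = 1 := by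
      rw [Int.cast_natCast, mul_comm (-Real.log S.toReal), Real.exp_nat_mul, Real.exp_neg,
        Real.exp_log hr, ← mul_pow, inv_mul_cancel₀ hr.ne', one_pow]
    rw [this]; simp
  · rw [hsplit, h]
    simp [Real.exp_log hr, ENNReal.ofReal_toReal hS]

/-- If the Green potential of the exponentially weighted boundary is finite, then `α ∈ Θ`, with an
explicit witness. -/
lemma exists_jgf_le_one (hμ : IsProb d μ) (hμ0 : IsProb d μ0) (h : H0 d μ μ0) (h1 : H1 d μ μ0)
    (h2 : H2 d μ) (h4 : H4 d μ μ0) (α : Fin (d - 1) → ℝ) (hfin : bdPot d μ μ0 α 0 ≠ ∞) :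
    ∃ β, jgf d μ (α, β) ≤ 1 ∧ jgf d μ0 (α, β) ≤ 1 := by
  set f : ℕ → ℝ≥0∞ := fun y => bdPot d μ μ0 α (0, y) with hf
  have hf0 : ∀ y, f y ≠ 0 := fun y hy => by
    have h5 : green d μ μ0 (0, y) (0, 0) * ex ((α, 0) : Rd d) (0, 0) ≤ f y :=
      ENNReal.le_tsum (f := fun x => green d μ μ0 (0, y) (x, 0) * ex ((α, 0) : Rd d) (x, 0)) 0
    rw [hy, nonpos_iff_eq_zero, mul_eq_zero] at h5
    exact h5.elim ((reach_pos h1 _ _).trans_le (reach_le_green μ μ0 _ _)).ne' (ex_ne_zero _ _)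
  have hftop : ∀ y, f y ≠ ∞ := fun y hy => by
    have h5 := reach_mul_bdPot_le (μ := μ) (μ0 := μ0) α 0 (0, y)
    change _ * f y ≤ _ at h5
    rw [hy, ENNReal.mul_top (reach_pos h1 _ _).ne'] at h5
    exact hfin (top_le_iff.1 h5)
  obtain ⟨δ, hδ, hδle⟩ := exists_le_reach h h1 h2 (0, -1)
  set S : ℝ≥0∞ := ⨆ y, f y / f (y + 1) with hS
  have hratio : ∀ y, f y ≤ S * f (y + 1) := fun y =>
    (ENNReal.div_le_iff (hf0 _) (hftop _)).1 (le_iSup (fun y => f y / f (y + 1)) y)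
  have hStop : S ≠ ∞ := by
    refine ne_top_of_le_ne_top (ENNReal.inv_ne_top.2 hδ.ne') (iSup_le fun y => ?_)
    rw [ENNReal.div_le_iff (hf0 _) (hftop _)]
    have h5 : δ * f y ≤ f (y + 1) := (mul_le_mul_left (hδle (0, y + 1) (0, y) (by simp [toZ])) _).trans
      (reach_mul_bdPot_le α _ _)
    calc f y ≤ δ⁻¹ * (δ * f y) := by
          rcases eq_or_ne δ ∞ with hd | hd
          · rw [hd, ENNReal.top_mul (hf0 y), top_le_iff] at h5
            exact absurd h5 (hftop _)
          · rw [← mul_assoc, ENNReal.inv_mul_cancel hδ.ne' hd, one_mul]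
      _ ≤ δ⁻¹ * f (y + 1) := mul_le_mul_right h5 _
  have hS0 : S ≠ 0 := fun h5 => hf0 0 (by simpa [h5] using hratio 0)
  have hpow : ∀ y j, f y ≤ S ^ j * f (y + j) := by
    intro y j
    induction j with
    | zero => simp
    | succ j ih =>
      refine ih.trans ?_
      rw [pow_succ, mul_assoc, ← add_assoc]
      exact mul_le_mul_right (hratio _) _
  set a : Rd d := (α, -Real.log S.toReal) with ha
  set g : Zd d → ℝ≥0∞ := fun w => ex ((α, 0) : Rd d) w * f w.2.toNat with hg
  have hgH : ∀ z, g (toZ d z) = bdPot d μ μ0 α z := fun z => by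
    rw [bdPot_eq]; simp [hg, hf, toZ]
  have hsup : ∀ z, ∑' w, step d μ μ0 z w * g (toZ d w) ≤ g (toZ d z) := fun z => by
    simp only [hgH]; exact tsum_step_bdPot_le α z
  have hg0 : ∀ y : ℕ, g (toZ d (0, y)) = f y := fun y => by
    simp [hgH, hf]
  have hgen : ∀ (y : ℕ) (w : Zd d), 0 ≤ w.2 → ex a w * f y ≤ g (toZ d (0, y) + w) := by
    intro y w hw
    obtain ⟨x, k⟩ := w
    obtain ⟨j, rfl⟩ : ∃ j : ℕ, k = j := ⟨k.toNat, (Int.toNat_of_nonneg hw).symm⟩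
    have h5 : ((toZ d (0, y) + ((x, (j : ℤ)) : Zd d)).2).toNat = y + j := by simp [toZ]; omega
    have h6 : ex ((α, 0) : Rd d) (toZ d (0, y) + ((x, (j : ℤ)) : Zd d)) =
        ex ((α, 0) : Rd d) (x, (j : ℤ)) := by simp [ex, dotZ, toZ]
    simp only [hg]
    rw [h5, h6]
    rw [← (ex_neg_log hS0 hStop α (x, (j : ℤ)) j).1 rfl, mul_assoc]
    exact mul_le_mul_right (hpow y j) _
  have hcancel : ∀ (m : ℝ≥0∞) y, m * f y ≤ f y → m ≤ 1 := fun m y hm => by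
    rw [← ENNReal.le_div_iff_mul_le (Or.inl (hf0 y)) (Or.inl (hftop y)),
      ENNReal.div_self (hf0 y) (hftop y)] at hm
    exact hm
  refine ⟨-Real.log S.toReal, ?_, ?_⟩
  · have hA : ∀ y, (∑' w : Zd d, if w.2 = -1 then ENNReal.ofReal (μ w) * ex ((α, 0) : Rd d) w else 0)
        * (f y / f (y + 1)) +
        (∑' w : Zd d, if 0 ≤ w.2 then ENNReal.ofReal (μ w) * ex a w else 0) ≤ 1 := by
      intro y
      refine hcancel _ (y + 1) ?_
      have h5 := hsup (0, y + 1)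
      rw [tsum_step h, if_neg (by simp), hg0] at h5
      refine le_trans ?_ h5
      rw [add_mul, mul_assoc, ENNReal.div_mul_cancel (hf0 _) (hftop _), ← ENNReal.tsum_mul_right,
        ← ENNReal.tsum_mul_right, ← ENNReal.tsum_add]
      refine ENNReal.tsum_le_tsum fun w => ?_
      by_cases hw : w.2 = -1
      · have h6 : ((toZ d (0, y + 1) + w).2).toNat = y := by simp [toZ, hw]
        have h7 : ex ((α, 0) : Rd d) (toZ d (0, y + 1) + w) = ex ((α, 0) : Rd d) w := by
          simp [ex, dotZ, toZ]
        simp only [hg]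
        rw [h6, h7]
        simp [hw, mul_assoc]
      · by_cases hw' : 0 ≤ w.2
        · simp only [hw, hw', if_true, if_false, zero_mul, zero_add, mul_assoc]
          exact mul_le_mul_right (hgen _ w hw') _
        · simp [hw, hw']
    have hB : mgf μ a ≤ 1 := by
      have h5 := iSup_le hA
      rw [← ENNReal.iSup_add, ← ENNReal.mul_iSup, ← hS, ← ENNReal.tsum_mul_right,
        ← ENNReal.tsum_add] at h5
      refine le_trans (ENNReal.tsum_le_tsum fun w => ?_) h5
      by_cases hw : w.2 = -1
      · rw [ha, (ex_neg_log hS0 hStop α w 0).2 hw]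
        simp [hw, mul_assoc]
      · by_cases hw' : 0 ≤ w.2
        · simp [hw, hw']
        · simp [h.1 w (by omega)]
    rw [mgf_eq hμ.1 (h4 a).1] at hB
    exact ENNReal.ofReal_le_one.1 hB
  · have hB : mgf μ0 a ≤ 1 := by
      refine hcancel _ 0 ?_
      have h5 := hsup (0, 0)
      rw [tsum_step h, if_pos rfl, hg0] at h5
      refine le_trans ?_ h5
      rw [mgf, ← ENNReal.tsum_mul_right]
      refine ENNReal.tsum_le_tsum fun w => ?_
      by_cases hw : 0 ≤ w.2
      · rw [mul_assoc]
        exact mul_le_mul_right (hgen 0 w hw) _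
      · simp [h.2 w (by omega)]
    rw [mgf_eq hμ0.1 (h4 a).2] at hB
    exact ENNReal.ofReal_le_one.1 hB

end BoundaryPotential

section Duality

variable {d : ℕ} {μ μ0 : Zd d → ℝ}

lemma mul_ex_comb (p : ℝ≥0∞) {s : ℝ} (hs0 : 0 ≤ s) (hs1 : s ≤ 1) (a b : Rd d) (w : Zd d) :
    p * ex ((1 - s) • a + s • b) w = (p * ex a w) ^ (1 - s) * (p * ex b w) ^ s := by
  have hs : 0 ≤ 1 - s := sub_nonneg.2 hs1
  have hp : p = p ^ (1 - s) * p ^ s := by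
    rw [← ENNReal.rpow_add_of_nonneg _ _ hs hs0]; simp
  rw [ENNReal.mul_rpow_of_nonneg _ _ hs, ENNReal.mul_rpow_of_nonneg _ _ hs0, ex_add_left, ex_smul,
    ex_smul]
  conv_lhs => rw [hp]
  ring

lemma exists_ex_eq_mul_wt (b : Rd d) {η : ℝ} (hη : 0 ≤ η) (w : Zd d) :
    ∃ b' : Rd d, ‖b' - b‖ ≤ η ∧ ex b w = ex b' w * wt η w := by
  have hsgn : ∀ k : ℤ, |((k.sign : ℤ) : ℝ)| ≤ 1 := fun k => by
    rw [abs_le]; exact_mod_cast abs_sign_le k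
  have hmul : ∀ k : ℤ, ((k.sign : ℤ) : ℝ) * k = |(k : ℝ)| := fun k => by
    exact_mod_cast Int.sign_mul_self_eq_abs k
  refine ⟨b + η • (fun i => (((w.1 i).sign : ℤ) : ℝ), ((w.2.sign : ℤ) : ℝ)), ?_, ?_⟩
  · rw [add_sub_cancel_left, norm_smul, Real.norm_of_nonneg hη]
    refine mul_le_of_le_one_right hη (max_le ?_ (hsgn _))
    exact (pi_norm_le_iff_of_nonneg zero_le_one).2 fun i => hsgn _
  · rw [ex, ex, wt, ← ENNReal.ofReal_mul (Real.exp_pos _).le, ← Real.exp_add, dotZ_add_left,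
      dotZ_smul_left]
    simp [dotZ, hmul]

lemma wt_rpow (c s : ℝ) (w : Zd d) : wt c w ^ s = wt (s * c) w := by
  rw [wt, ENNReal.ofReal_rpow_of_pos (Real.exp_pos _), ← Real.exp_mul, wt]
  congr 2
  ring

lemma stepSn_mul_ex_le (hμ : IsProb d μ) (h4 : H4 d μ μ0) {a : Rd d} {θ : ℝ}
    (ha : jgf d μ a ≤ θ) (n : ℕ) (w : Zd d) :
    stepSn d μ n 0 w * ex a w ≤ ENNReal.ofReal θ ^ n := by
  refine (ENNReal.le_tsum (f := fun w => stepSn d μ n 0 w * ex a w) w).trans ?_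
  rw [tsum_stepSn_ex, ex_zero, mul_one, mgf_eq hμ.1 (h4 a).1]
  gcongr

lemma bdPot_ne_top (hμ : IsProb d μ) (hμ0 : IsProb d μ0) (h : H0 d μ μ0) (h4 : H4 d μ μ0)
    {a b : Rd d} {η θ s : ℝ} (hη : 0 < η) (hθ : θ < 1)
    (hb : ∀ a, ‖a - b‖ ≤ η → jgf d μ a ≤ θ ∧ jgf d μ0 a ≤ θ)
    (hD1 : ∀ n x, stepn d μ μ0 n 0 (x, 0) * ex a (x, 0) ≤ 1) (hs0 : 0 < s) (hs1 : s ≤ 1) :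
    bdPot d μ μ0 ((1 - s) • a + s • b).1 0 ≠ ∞ := by
  have hterm : ∀ n (x : Fin (d - 1) → ℤ), stepn d μ μ0 n 0 (x, 0) *
      ex ((((1 - s) • a + s • b).1, 0) : Rd d) (x, 0) ≤
      (ENNReal.ofReal θ ^ s) ^ n * wt (s * η) (x, 0) := by
    intro n x
    have h5 : ex ((((1 - s) • a + s • b).1, 0) : Rd d) (x, 0) =
        ex ((1 - s) • a + s • b) (x, 0) := by simp [ex, dotZ]
    rw [h5, mul_ex_comb _ hs0.le hs1]
    obtain ⟨b', hb', hbe⟩ := exists_ex_eq_mul_wt b hη.le (x, 0)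
    have h6 : stepn d μ μ0 n 0 (x, 0) * ex b (x, 0) ≤ ENNReal.ofReal θ ^ n * wt η (x, 0) := by
      rw [hbe, ← mul_assoc]
      refine mul_le_mul_left ?_ _
      simpa [toZ, ex_zero, ← Prod.zero_eq_mk] using
        stepn_mul_ex_le hμ hμ0 h h4 (hb b' hb').1 (hb b' hb').2 n 0 (x, 0)
    calc _ ≤ 1 * (ENNReal.ofReal θ ^ n * wt η (x, 0)) ^ s :=
          mul_le_mul' (ENNReal.rpow_le_one (hD1 n x) (sub_nonneg.2 hs1))
            (ENNReal.rpow_le_rpow h6 hs0.le)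
      _ = _ := by
          rw [one_mul, ENNReal.mul_rpow_of_nonneg _ _ hs0.le, wt_rpow, ← ENNReal.rpow_natCast,
            ← ENNReal.rpow_mul, mul_comm (n : ℝ), ENNReal.rpow_mul, ENNReal.rpow_natCast]
  have hle : bdPot d μ μ0 ((1 - s) • a + s • b).1 0 ≤
      (1 - ENNReal.ofReal θ ^ s)⁻¹ * ∑' x : Fin (d - 1) → ℤ, wt (s * η) ((x, 0) : Zd d) := by
    rw [bdPot, ← ENNReal.tsum_geometric, ← ENNReal.tsum_mul_left]
    refine ENNReal.tsum_le_tsum fun x => ?_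
    rw [green, ← ENNReal.tsum_mul_right, ← ENNReal.tsum_mul_right]
    exact ENNReal.tsum_le_tsum fun n => hterm n x
  refine ne_top_of_le_ne_top (ENNReal.mul_ne_top ?_ (tsum_wt_boundary_ne_top (by positivity))) hle
  rw [ENNReal.inv_ne_top]
  exact (tsub_pos_of_lt (ENNReal.rpow_lt_one (ENNReal.ofReal_lt_one.2 hθ) hs0)).ne'

lemma le_of_pow_le {x y C : ℝ} (hy : 0 < y) (h : ∀ n : ℕ, x ^ n ≤ C * y ^ n) : x ≤ y := by
  by_contra! hxy
  have h1 : 1 < x / y := (one_lt_div hy).2 hxy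
  obtain ⟨n, hn⟩ := pow_unbounded_of_one_lt C h1
  rw [div_pow, lt_div_iff₀ (by positivity)] at hn
  exact absurd (h n) (not_le.2 hn)

lemma jgf_comb_le_one (hμ : IsProb d μ) (h4 : H4 d μ μ0)
    {a b : Rd d} {s β' : ℝ} (hb : jgf d μ b ≤ 1)
    (hD2 : ∀ n (w : Zd d), 0 ≤ w.2 → stepSn d μ n 0 w * ex a w ≤ 1) (hs0 : 0 < s) (hs1 : s ≤ 1)
    (hβ : jgf d μ (((1 - s) • a + s • b).1, β') ≤ 1) (hββ : β' ≤ ((1 - s) • a + s • b).2) :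
    jgf d μ ((1 - s) • a + s • b) ≤ 1 := by
  set c := (1 - s) • a + s • b with hc
  obtain ⟨M, hM1, hM⟩ : ∃ M : ℝ, 1 ≤ M ∧ ∀ x, ‖x - c‖ ≤ 1 → jgf d μ x ≤ M := by
    obtain ⟨M, hM⟩ := (isCompact_closedBall c 1).bddAbove_image
      (continuous_jgf hμ.1 fun a => (h4 a).1).continuousOn
    exact ⟨max 1 M, le_max_left _ _, fun x hx => le_max_of_le_right
      (hM ⟨x, mem_closedBall_iff_norm.2 hx, rfl⟩)⟩
  have hM0 : 0 < M := by linarith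
  have key : ∀ u : ℝ, 0 < u → u ≤ 1 → jgf d μ c ≤ M ^ u := by
    intro u hu0 hu1
    set K := ∑' w : Zd d, wt u w with hK
    have hKtop : K ≠ ∞ := tsum_wt_ne_top hu0
    refine le_of_pow_le (C := 1 + K.toReal) (by positivity) fun n => ?_
    have h5 : mgf μ c ^ n ≤ 1 + ENNReal.ofReal (M ^ u) ^ n * K := by
      have h6 : ∀ w, stepSn d μ n 0 w * ex c w ≤ stepSn d μ n 0 w * ex ((c.1, β') : Rd d) w +
          ENNReal.ofReal (M ^ u) ^ n * wt u w := by
        intro w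
        rcases lt_or_ge w.2 0 with hw | hw
        · refine le_add_right (mul_le_mul_right (ENNReal.ofReal_le_ofReal
            (Real.exp_le_exp.2 ?_)) _)
          simp only [dotZ]
          have : (w.2 : ℝ) ≤ 0 := by exact_mod_cast hw.le
          nlinarith
        · refine le_add_left ?_
          have hX : stepSn d μ n 0 w * ex c w ≤ 1 := by
            rw [hc, mul_ex_comb _ hs0.le hs1]
            refine mul_le_one' (ENNReal.rpow_le_one (hD2 n w hw) (sub_nonneg.2 hs1))
              (ENNReal.rpow_le_one ?_ hs0.le)
            simpa using stepSn_mul_ex_le hμ h4 hb n w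
          obtain ⟨c', hc', hce⟩ := exists_ex_eq_mul_wt c zero_le_one w
          calc stepSn d μ n 0 w * ex c w = (stepSn d μ n 0 w * ex c w) ^ (1 : ℝ) := by simp
            _ ≤ (stepSn d μ n 0 w * ex c w) ^ u := ENNReal.rpow_le_rpow_of_exponent_ge hX hu1
            _ ≤ (ENNReal.ofReal M ^ n * wt 1 w) ^ u := by
                refine ENNReal.rpow_le_rpow ?_ hu0.le
                rw [hce, ← mul_assoc]
                exact mul_le_mul_left (stepSn_mul_ex_le hμ h4 (hM c' hc') n w) _
            _ = _ := by
                rw [ENNReal.mul_rpow_of_nonneg _ _ hu0.le, wt_rpow, ← ENNReal.rpow_natCast,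
                  ← ENNReal.rpow_mul, mul_comm (n : ℝ), ENNReal.rpow_mul, ENNReal.rpow_natCast,
                  ENNReal.ofReal_rpow_of_pos hM0, mul_one]
      have h7 := ENNReal.tsum_le_tsum h6
      rw [ENNReal.tsum_add, tsum_stepSn_ex, tsum_stepSn_ex, ex_zero, ex_zero, mul_one, mul_one,
        ENNReal.tsum_mul_left] at h7
      refine h7.trans (add_le_add_left (pow_le_one₀ zero_le ?_) _)
      rw [mgf_eq hμ.1 (h4 _).1]
      exact ENNReal.ofReal_le_one.2 hβ
    have hMu : 0 < M ^ u := by positivity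
    have h8 := ENNReal.toReal_mono (by finiteness) h5
    rw [mgf_eq hμ.1 (h4 _).1, ENNReal.toReal_add (by simp) (by finiteness)] at h8
    simp only [ENNReal.toReal_pow, ENNReal.toReal_mul, ENNReal.toReal_ofReal (jgf_nonneg hμ.1 c),
      ENNReal.toReal_ofReal hMu.le, ENNReal.toReal_one] at h8
    have h9 : 1 ≤ (M ^ u) ^ n := one_le_pow₀ (Real.one_le_rpow hM1 hu0.le)
    nlinarith
  have hlim : Tendsto (fun u : ℝ => M ^ u) (nhdsWithin 0 (Set.Ioi 0)) (nhds 1) := by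
    have := (Real.continuous_const_rpow hM0.ne').tendsto 0
    rw [Real.rpow_zero] at this
    exact this.mono_left nhdsWithin_le_nhds
  refine ge_of_tendsto hlim ?_
  filter_upwards [Ioc_mem_nhdsGT one_pos] with u hu
  exact key u hu.1 hu.2

/-- A linear functional that is dominated on boundary excursions and on the interior walk is
dominated by the support function of `D̂`. -/
lemma dotR_le_of_dual (hμ : IsProb d μ) (hμ0 : IsProb d μ0) (h : H0 d μ μ0) (h1 : H1 d μ μ0)
    (h2 : H2 d μ) (h3 : H3 d μ μ0) (h4 : H4 d μ μ0) {a : Rd d}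
    (hD1 : ∀ n x, stepn d μ μ0 n 0 (x, 0) * ex a (x, 0) ≤ 1)
    (hD2 : ∀ n (w : Zd d), 0 ≤ w.2 → stepSn d μ n 0 w * ex a w ≤ 1) {q : Rd d} (hq : 0 ≤ q.2) :
    dotR d a q ≤ ⨆ a : Dhat d μ μ0, dotR d (a : Rd d) q := by
  obtain ⟨b, η, θ, hη, hθ, hb⟩ := exists_ball_jgf_le hμ hμ0 h3 h4
  have hbdd := bddAbove_dotR (μ0 := μ0) hμ h2 h4 q
  have key : ∀ s : ℝ, 0 < s → s ≤ 1 →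
      (1 - s) * dotR d a q + s * dotR d b q ≤ ⨆ a : Dhat d μ μ0, dotR d (a : Rd d) q := by
    intro s hs0 hs1
    rw [← dotR_smul_left, ← dotR_smul_left, ← dotR_add_left]
    obtain ⟨β', hβ, hβ0⟩ := exists_jgf_le_one hμ hμ0 h h1 h2 h4 _
      (bdPot_ne_top hμ hμ0 h h4 hη hθ hb hD1 hs0 hs1)
    have hΘ := mem_Theta_of hμ hβ hβ0
    rcases le_total β' ((1 - s) • a + s • b).2 with hββ | hββ
    · have h5 : (1 - s) • a + s • b ∈ Dhat d μ μ0 := ⟨hΘ, jgf_comb_le_one hμ h4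
        ((hb b (by simpa using hη.le)).1.trans hθ.le) hD2 hs0 hs1 hβ hββ⟩
      exact le_ciSup hbdd ⟨_, h5⟩
    · refine le_trans ?_ (le_ciSup hbdd ⟨_, (⟨hΘ, hβ⟩ : (_, β') ∈ Dhat d μ μ0)⟩)
      exact add_le_add_right (mul_le_mul_of_nonneg_right hββ hq) _
  have hlim : Tendsto (fun s : ℝ => (1 - s) * dotR d a q + s * dotR d b q)
      (nhdsWithin 0 (Set.Ioi 0)) (nhds (dotR d a q)) := by
    have : Continuous fun s : ℝ => (1 - s) * dotR d a q + s * dotR d b q := by fun_prop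
    have := this.tendsto 0
    simp only [sub_zero, one_mul, zero_mul, add_zero] at this
    exact this.mono_left nhdsWithin_le_nhds
  refine le_of_tendsto hlim ?_
  filter_upwards [Ioc_mem_nhdsGT one_pos] with s hs
  exact key s hs.1 hs.2

end Duality

section AttainedPairs

variable {d : ℕ} {μ μ0 : Zd d → ℝ}

lemma toR_add (z w : Zd d) : toR d (z + w) = toR d z + toR d w := by
  ext <;> simp [toR]

lemma toR_zero : toR d 0 = 0 := by
  ext <;> simp [toR]

lemma toR_nsmul (k : ℕ) (w : Zd d) : toR d (k • w) = (k : ℝ) • toR d w := by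
  ext <;> simp [toR]

/-- `(v, c)` is attained if displacement `T v` costs at most `cT + O(1)`, through an excursion
along the boundary followed by a piece of path that can be started at any large height. -/
def Attained (d : ℕ) (μ μ0 : Zd d → ℝ) (v : Rd d × ℝ) : Prop :=
  ∃ A : ℝ, 0 ≤ A ∧ ∀ T : ℝ, 0 ≤ T → ∃ (x : Fin (d - 1) → ℤ) (w : Zd d), 0 ≤ w.2 ∧
    ‖toR d ((x, 0) + w) - T • v.1‖ ≤ A ∧ ∀ z z' : St d, A ≤ z.2 → toZ d z' = toZ d z + w →
      ENNReal.ofReal (Real.exp (-(v.2 * T) - A)) ≤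
        reach (step d μ μ0) 0 (x, 0) * reach (step d μ μ0) z z'

lemma Attained.add {v v' : Rd d × ℝ} (h : Attained d μ μ0 v) (h' : Attained d μ μ0 v') :
    Attained d μ μ0 (v + v') := by
  obtain ⟨A, hA, h⟩ := h
  obtain ⟨A', hA', h'⟩ := h'
  refine ⟨A + A', by positivity, fun T hT => ?_⟩
  obtain ⟨x, w, hw, hn, hr⟩ := h T hT
  obtain ⟨x', w', hw', hn', hr'⟩ := h' T hT
  refine ⟨x + x', w + w', add_nonneg hw hw', ?_, fun z z' hz hzz => ?_⟩
  · have : toR d ((x + x', 0) + (w + w')) - T • (v + v').1 =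
        (toR d ((x, 0) + w) - T • v.1) + (toR d ((x', 0) + w') - T • v'.1) := by
      have h5 : ((x + x', 0) + (w + w') : Zd d) = ((x, 0) + w) + ((x', 0) + w') := by
        ext <;> (simp; try ring)
      rw [h5, toR_add _ ((x', 0) + w'), Prod.fst_add, smul_add]
      abel
    rw [this]
    exact (norm_add_le _ _).trans (add_le_add hn hn')
  · set u : St d := ((toZ d z + w).1, (toZ d z + w).2.toNat) with hu
    have hu0 : 0 ≤ (toZ d z + w).2 := by
      have : 0 ≤ (toZ d z).2 := by simp [toZ]
      exact add_nonneg this hw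
    have hzu : toZ d u = toZ d z + w := toZ_mk_toNat hu0
    have hzu2 : (z.2 : ℝ) ≤ u.2 := by
      have : ((u.2 : ℕ) : ℤ) = z.2 + w.2 := congrArg Prod.snd hzu
      have h6 : z.2 ≤ u.2 := by omega
      exact_mod_cast h6
    have e1 := hr z u (by linarith) hzu
    have e2 := hr' u z' (by linarith) (by rw [hzz, hzu, add_assoc])
    have e3 : reach (step d μ μ0) 0 (x', 0) = reach (step d μ μ0) (x, 0) (x + x', 0) := by
      rw [← reach_shift μ μ0 x 0 (x', 0), shift_mk]
      congr 1
      ext <;> simp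
    rw [e3] at e2
    calc ENNReal.ofReal (Real.exp (-((v + v').2 * T) - (A + A')))
        = ENNReal.ofReal (Real.exp (-(v.2 * T) - A)) *
          ENNReal.ofReal (Real.exp (-(v'.2 * T) - A')) := by
          rw [← ENNReal.ofReal_mul (Real.exp_pos _).le, ← Real.exp_add, Prod.snd_add]
          congr 2
          ring
      _ ≤ (reach (step d μ μ0) 0 (x, 0) * reach (step d μ μ0) z u) *
          (reach (step d μ μ0) (x, 0) (x + x', 0) * reach (step d μ μ0) u z') :=
          mul_le_mul' e1 e2
      _ = (reach (step d μ μ0) 0 (x, 0) * reach (step d μ μ0) (x, 0) (x + x', 0)) *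
          (reach (step d μ μ0) z u * reach (step d μ μ0) u z') := by ring
      _ ≤ _ := mul_le_mul' (reach_mul_le _ _ _ _) (reach_mul_le _ _ _ _)

lemma Attained.smul {v : Rd d × ℝ} (h : Attained d μ μ0 v) {s : ℝ} (hs : 0 ≤ s) :
    Attained d μ μ0 (s • v) := by
  obtain ⟨A, hA, h⟩ := h
  refine ⟨A, hA, fun T hT => ?_⟩
  obtain ⟨x, w, hw, hn, hr⟩ := h (s * T) (by positivity)
  refine ⟨x, w, hw, ?_, fun z z' hz hzz => ?_⟩
  · rwa [Prod.smul_fst, smul_smul, mul_comm]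
  · rw [Prod.smul_snd, smul_eq_mul, mul_comm s, mul_assoc]
    exact hr z z' hz hzz

lemma toZ_eq_self {z z' : St d} (h : toZ d z' = toZ d z + 0) : z' = z := by
  rw [add_zero] at h
  exact toZ_injective h

lemma attained_zero_right {c : ℝ} (hc : 0 ≤ c) : Attained d μ μ0 (0, c) := by
  refine ⟨0, le_rfl, fun T hT => ⟨0, 0, le_rfl, ?_, fun z z' _ hz => ?_⟩⟩
  · rw [← Prod.zero_eq_mk, add_zero, toR_zero]; simp
  · rw [toZ_eq_self hz]
    refine le_trans ?_ (mul_le_mul' (one_le_reach_self (step d μ μ0) 0)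
      (one_le_reach_self (step d μ μ0) z))
    rw [mul_one, ← ENNReal.ofReal_one]
    refine ENNReal.ofReal_le_ofReal (Real.exp_le_one_iff.2 ?_)
    have : 0 ≤ c * T := by positivity
    simpa using this

/-- The convex cone of attained pairs. -/
def attainedCone (d : ℕ) (μ μ0 : Zd d → ℝ) : PointedCone ℝ (Rd d × ℝ) where
  carrier := {v | Attained d μ μ0 v}
  add_mem' := Attained.add
  zero_mem' := attained_zero_right le_rfl
  smul_mem' s _ h := Attained.smul h s.2

lemma exp_floor_le {c T : ℝ} (hT : 0 ≤ T) {p : ℝ≥0∞} (hp0 : p ≠ 0) (hp : p ≠ ∞)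
    (hc : c = -Real.log p.toReal) {A : ℝ} (hA : |c| ≤ A) :
    ENNReal.ofReal (Real.exp (-(c * T) - A)) ≤ p ^ ⌊T⌋₊ := by
  have hr : 0 < p.toReal := ENNReal.toReal_pos hp0 hp
  rw [← ENNReal.ofReal_toReal hp, ← ENNReal.ofReal_pow hr.le]
  refine ENNReal.ofReal_le_ofReal ?_
  rw [← Real.exp_log (pow_pos hr _), Real.log_pow]
  refine Real.exp_le_exp.2 ?_
  have h1 := Nat.floor_le hT
  have h2 := (Nat.lt_floor_add_one T).le
  have h3 : Real.log p.toReal = -c := by linarith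
  rw [h3]
  have h4 : |c * (T - ⌊T⌋₊)| ≤ A := by
    rw [abs_mul, abs_of_nonneg (by linarith : 0 ≤ T - ⌊T⌋₊)]
    exact (mul_le_of_le_one_right (abs_nonneg c) (by linarith)).trans hA
  have := (abs_le.1 h4).1
  linarith

lemma norm_floor_smul_sub_le {v : Rd d} {T : ℝ} (hT : 0 ≤ T) :
    ‖(⌊T⌋₊ : ℝ) • v - T • v‖ ≤ ‖v‖ := by
  rw [← sub_smul, norm_smul]
  refine mul_le_of_le_one_left (norm_nonneg v) ?_
  rw [Real.norm_eq_abs, abs_le]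
  constructor <;> linarith [Nat.floor_le hT, (Nat.lt_floor_add_one T).le]

lemma stepn_le_one (hμ : IsProb d μ) (hμ0 : IsProb d μ0) (h : H0 d μ μ0) (h4 : H4 d μ μ0)
    (n : ℕ) (z z' : St d) : stepn d μ μ0 n z z' ≤ 1 := by
  simpa [ex, dotZ] using stepn_mul_ex_le hμ hμ0 h h4 (jgf_zero hμ).le (jgf_zero hμ0).le n z z'

lemma stepSn_le_one (hμ : IsProb d μ) (h4 : H4 d μ μ0)
    (n : ℕ) (w : Zd d) : stepSn d μ n 0 w ≤ 1 := by
  simpa [ex, dotZ] using stepSn_mul_ex_le hμ h4 (jgf_zero hμ).le n w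

lemma attained_boundary (hμ : IsProb d μ) (hμ0 : IsProb d μ0) (h : H0 d μ μ0) (h4 : H4 d μ μ0)
    (n : ℕ) (x : Fin (d - 1) → ℤ) (hp : stepn d μ μ0 n 0 (x, 0) ≠ 0) :
    Attained d μ μ0 (toR d (x, 0), -Real.log (stepn d μ μ0 n 0 (x, 0)).toReal) := by
  set p := stepn d μ μ0 n 0 (x, 0)
  set c := -Real.log p.toReal with hc
  have hptop : p ≠ ∞ := ne_top_of_le_ne_top ENNReal.one_ne_top (stepn_le_one hμ hμ0 h h4 n _ _)
  have hpow : ∀ k : ℕ, p ^ k ≤ reach (step d μ μ0) 0 (k • x, 0) := by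
    intro k
    induction k with
    | zero => simpa [← Prod.zero_eq_mk] using one_le_reach_self (step d μ μ0) (0 : St d)
    | succ k ih =>
      rw [pow_succ]
      refine le_trans (mul_le_mul' ih ?_) (reach_mul_le (step d μ μ0) 0 (k • x, 0) _)
      have e3 : reach (step d μ μ0) (k • x, 0) ((k + 1) • x, 0) =
          reach (step d μ μ0) 0 (x, 0) := by
        rw [← reach_shift μ μ0 (k • x) 0 (x, 0), shift_mk, succ_nsmul]
        congr 1
        ext <;> simp
      rw [e3]
      exact kerIter_le_reach _ n _ _
  refine ⟨‖toR d ((x, 0) : Zd d)‖ + |c|, by positivity, fun T hT =>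
    ⟨⌊T⌋₊ • x, 0, le_rfl, ?_, fun z z' _ hz => ?_⟩⟩
  · have : ((⌊T⌋₊ • x, 0) + 0 : Zd d) = ⌊T⌋₊ • (x, 0) := by ext <;> simp
    rw [this, toR_nsmul]
    exact (norm_floor_smul_sub_le hT).trans (le_add_of_nonneg_right (abs_nonneg c))
  · rw [toZ_eq_self hz]
    refine le_trans ?_ (mul_le_mul' (hpow ⌊T⌋₊) (one_le_reach_self (step d μ μ0) z))
    rw [mul_one]
    exact exp_floor_le hT hp hptop hc (le_add_of_nonneg_left (norm_nonneg _))

lemma attained_interior (hμ : IsProb d μ) (h : H0 d μ μ0) (h4 : H4 d μ μ0)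
    (n : ℕ) {w : Zd d} (hw : 0 ≤ w.2) (hp : stepSn d μ n 0 w ≠ 0) :
    Attained d μ μ0 (toR d w, -Real.log (stepSn d μ n 0 w).toReal) := by
  set p := stepSn d μ n 0 w with hpdef
  set c := -Real.log p.toReal with hc
  have hptop : p ≠ ∞ := ne_top_of_le_ne_top ENNReal.one_ne_top (stepSn_le_one hμ h4 n _)
  have hpow : ∀ (k : ℕ) (z z' : St d), n ≤ z.2 → toZ d z' = toZ d z + k • w →
      p ^ k ≤ reach (step d μ μ0) z z' := by
    intro k
    induction k with
    | zero =>
      intro z z' _ hz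
      rw [zero_nsmul] at hz
      rw [toZ_eq_self hz, pow_zero]
      exact one_le_reach_self _ z
    | succ k ih =>
      intro z z' hzn hz
      have hu0 : 0 ≤ (toZ d z + k • w).2 := by
        have : 0 ≤ (toZ d z).2 := by simp [toZ]
        exact add_nonneg this (nsmul_nonneg hw k)
      set u : St d := ((toZ d z + k • w).1, (toZ d z + k • w).2.toNat) with hu
      have hzu : toZ d u = toZ d z + k • w := toZ_mk_toNat hu0
      have hun : n ≤ u.2 := by
        have h5 : ((u.2 : ℕ) : ℤ) = z.2 + k • w.2 := congrArg Prod.snd hzu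
        have h6 := nsmul_nonneg hw k
        omega
      rw [pow_succ]
      refine le_trans (mul_le_mul' (ih z u hzn hzu) ?_) (reach_mul_le _ z u z')
      exact stepSn_le_reach h n hun (by rw [hz, hzu, succ_nsmul, add_assoc])
  refine ⟨‖toR d w‖ + |c| + n, by positivity, fun T hT =>
    ⟨0, ⌊T⌋₊ • w, nsmul_nonneg hw _, ?_, fun z z' hzn hz => ?_⟩⟩
  · rw [← Prod.zero_eq_mk, zero_add, toR_nsmul]
    exact (norm_floor_smul_sub_le hT).trans (by linarith [abs_nonneg c, Nat.cast_nonneg (α := ℝ) n])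
  · have hn : n ≤ z.2 := by
      have : (n : ℝ) ≤ z.2 := by linarith [abs_nonneg c, norm_nonneg (toR d w)]
      exact_mod_cast this
    refine le_trans ?_ (mul_le_mul' (one_le_reach_self (step d μ μ0) 0) (hpow ⌊T⌋₊ z z' hn hz))
    rw [one_mul]
    exact exp_floor_le hT hp hptop hc
      (by linarith [norm_nonneg (toR d w), Nat.cast_nonneg (α := ℝ) n])

lemma le_neg_log {p : ℝ≥0∞} {a : Rd d} {w : Zd d} (hp : p ≠ ∞)
    (h : p ≠ 0 → dotZ d a w ≤ -Real.log p.toReal) : p * ex a w ≤ 1 := by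
  rcases eq_or_ne p 0 with rfl | hp0
  · simp
  have hr : 0 < p.toReal := ENNReal.toReal_pos hp0 hp
  rw [ex, ← ENNReal.ofReal_toReal hp, ← ENNReal.ofReal_mul hr.le]
  refine ENNReal.ofReal_le_one.2 ?_
  rw [← Real.exp_log hr, ← Real.exp_add]
  exact Real.exp_le_one_iff.2 (by linarith [h hp0])

lemma exists_dotR_of_clm (f : StrongDual ℝ (Rd d × ℝ)) :
    ∃ (a : Rd d) (κ : ℝ), ∀ v c, f (v, c) = dotR d a v + κ * c := by
  refine ⟨(fun i => f ((Pi.single i 1, 0), 0), f ((0, 1), 0)), f (0, 1), fun v c => ?_⟩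
  have hv : (v, c) = (∑ i, v.1 i • (((Pi.single i 1, 0), 0) : Rd d × ℝ)) +
      v.2 • (((0, 1), 0) : Rd d × ℝ) + c • ((0, 1) : Rd d × ℝ) := by
    ext i
    · simp [Prod.fst_sum, Finset.sum_apply, Pi.single_apply]
    · simp [Prod.fst_sum, Prod.snd_sum]
    · simp [Prod.snd_sum]
  rw [hv, map_add, map_add, map_sum]
  simp only [map_smul, smul_eq_mul, dotR]
  congr 1
  · congr 1
    · exact Finset.sum_congr rfl fun i _ => mul_comm _ _
    · ring
  · ring

/-- By duality, the support function of `D̂` is in the closure of the attained pairs. -/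
lemma mem_closure_attained (hμ : IsProb d μ) (hμ0 : IsProb d μ0) (h : H0 d μ μ0) (h1 : H1 d μ μ0)
    (h2 : H2 d μ) (h3 : H3 d μ μ0) (h4 : H4 d μ μ0) {q : Rd d} (hq : 0 ≤ q.2) :
    (q, ⨆ a : Dhat d μ μ0, dotR d (a : Rd d) q) ∈ closure {v | Attained d μ μ0 v} := by
  set J := ⨆ a : Dhat d μ μ0, dotR d (a : Rd d) q with hJ
  by_contra hcon
  set C : ProperCone ℝ (Rd d × ℝ) := ⟨(attainedCone d μ μ0).closure, isClosed_closure⟩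
  have hcon' : (q, J) ∉ C := hcon
  obtain ⟨f, hf, hfq⟩ := C.hyperplane_separation_point hcon'
  have hfA : ∀ v, Attained d μ μ0 v → 0 ≤ f v := fun v hv => hf v (subset_closure hv)
  obtain ⟨a, κ, haκ⟩ := exists_dotR_of_clm f
  have hκ : 0 ≤ κ := by
    have := hfA (0, 1) (attained_zero_right zero_le_one)
    rw [haκ] at this
    simpa [dotR] using this
  have hB : ∀ n x, stepn d μ μ0 n 0 (x, 0) ≠ 0 →
      0 ≤ dotZ d a (x, 0) + κ * -Real.log (stepn d μ μ0 n 0 (x, 0)).toReal := by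
    intro n x hp
    have := hfA _ (attained_boundary hμ hμ0 h h4 n x hp)
    rwa [haκ, dotR_toR] at this
  have hI : ∀ n (w : Zd d), 0 ≤ w.2 → stepSn d μ n 0 w ≠ 0 →
      0 ≤ dotZ d a w + κ * -Real.log (stepSn d μ n 0 w).toReal := by
    intro n w hw hp
    have := hfA _ (attained_interior (μ0 := μ0) hμ h h4 n hw hp)
    rwa [haκ, dotR_toR] at this
  rw [haκ] at hfq
  rcases hκ.eq_or_lt with rfl | hκ
  · simp only [zero_mul, add_zero] at hB hI hfq
    have hB' : ∀ x : Fin (d - 1) → ℤ, 0 ≤ dotZ d a (x, 0) := fun x =>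
      let ⟨n, hn⟩ := h1 0 (x, 0)
      hB n x hn.ne'
    have ha1 : ∀ i, a.1 i = 0 := fun i => by
      have e1 := hB' (Pi.single i 1)
      have e2 := hB' (Pi.single i (-1))
      simp [dotZ, Pi.single_apply, apply_ite] at e1 e2
      linarith
    have ha2 : 0 ≤ a.2 := by
      obtain ⟨n, hn⟩ := h2.1 0 (0, 1)
      simpa [dotZ] using hI n (0, 1) zero_le_one hn.ne'
    have : 0 ≤ dotR d a q := by
      simp only [dotR, ha1, zero_mul, Finset.sum_const_zero, zero_add]
      positivity
    linarith
  · have hdiv : ∀ {w : Zd d} {l : ℝ}, 0 ≤ dotZ d a w + κ * -l → dotZ d (-κ⁻¹ • a) w ≤ -l := by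
      intro w l hl
      rw [dotZ_smul_left, neg_mul, neg_le_neg_iff, ← div_eq_inv_mul, le_div_iff₀ hκ]
      linarith
    have := dotR_le_of_dual hμ hμ0 h h1 h2 h3 h4 (a := -κ⁻¹ • a)
      (fun n x => le_neg_log (ne_top_of_le_ne_top ENNReal.one_ne_top
        (stepn_le_one hμ hμ0 h h4 n _ _)) fun hp => hdiv (hB n x hp))
      (fun n w hw => le_neg_log (ne_top_of_le_ne_top ENNReal.one_ne_top
        (stepSn_le_one hμ h4 n w)) fun hp => hdiv (hI n w hw hp)) hq
    rw [dotR_smul_left, ← hJ, neg_mul, neg_le, ← div_eq_inv_mul, le_div_iff₀ hκ] at this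
    linarith

end AttainedPairs

section Bounds
variable {d : ℕ} {μ μ0 : Zd d → ℝ}

lemma Attained.exists_le_reach {C : ℝ} (hC0 : 0 ≤ C) (hC : ∀ z z' : St d,
      ENNReal.ofReal (Real.exp (-(C * (‖toR d (toZ d z') - toR d (toZ d z)‖ + 1)))) ≤
        reach (step d μ μ0) z z') {v : Rd d × ℝ} (hv : Attained d μ μ0 v) (z : St d) :
    ∃ B : ℝ, ∀ T : ℝ, 0 ≤ T → ∀ z' : St d,
      ENNReal.ofReal (Real.exp (-(v.2 * T + B + C * ‖toR d (toZ d z') - T • v.1‖))) ≤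
        reach (step d μ μ0) z z' := by
  obtain ⟨A, hA, hv⟩ := hv
  set N := ⌈A⌉₊ with hN
  set R0 := C * (‖toR d (toZ d 0) - toR d (toZ d z)‖ + 1) with hR0
  set R1 := C * (‖toR d (toZ d (0, N)) - toR d (toZ d 0)‖ + 1) with hR1
  set R2 := C * (A + ‖toR d (toZ d (0, N))‖ + 1) with hR2
  refine ⟨R0 + R1 + A + R2, fun T hT z' => ?_⟩
  obtain ⟨x, w, hw, hn, hr⟩ := hv T hT
  have hu0 : 0 ≤ (toZ d (x, N) + w).2 := by
    have : 0 ≤ (toZ d (x, N)).2 := by simp [toZ]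
    exact add_nonneg this hw
  set u : St d := ((toZ d (x, N) + w).1, (toZ d (x, N) + w).2.toNat) with hu
  have hzu : toZ d u = toZ d (x, N) + w := toZ_mk_toNat hu0
  have e0 := hC z 0
  have e1 : ENNReal.ofReal (Real.exp (-R1)) ≤ reach (step d μ μ0) (x, 0) (x, N) := by
    have := hC 0 (0, N)
    rwa [← reach_shift μ μ0 x, Prod.zero_eq_mk, shift_mk, shift_mk, add_zero,
      ← Prod.zero_eq_mk] at this
  have e2 := hr (x, N) u (Nat.le_ceil A) hzu
  have e3 : ENNReal.ofReal (Real.exp (-(R2 + C * ‖toR d (toZ d z') - T • v.1‖))) ≤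
      reach (step d μ μ0) u z' := by
    refine le_trans (ENNReal.ofReal_le_ofReal (Real.exp_le_exp.2 (neg_le_neg ?_))) (hC u z')
    rw [hR2, ← mul_add]
    refine mul_le_mul_of_nonneg_left ?_ hC0
    have h5 : toR d (toZ d u) = toR d ((x, 0) + w) + toR d (toZ d (0, N)) := by
      rw [hzu, ← toR_add]
      congr 1
      ext <;> simp [toZ, add_comm]
    have h6 : toR d (toZ d z') - toR d (toZ d u) = (toR d (toZ d z') - T • v.1) -
        (toR d ((x, 0) + w) - T • v.1) - toR d (toZ d (0, N)) := by
      rw [h5]; abel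
    rw [h6]
    have h7 := norm_sub_le (toR d (toZ d z') - T • v.1 - (toR d ((x, 0) + w) - T • v.1))
      (toR d (toZ d (0, N)))
    have h8 := norm_sub_le (toR d (toZ d z') - T • v.1) (toR d ((x, 0) + w) - T • v.1)
    linarith
  calc ENNReal.ofReal
        (Real.exp (-(v.2 * T + (R0 + R1 + A + R2) + C * ‖toR d (toZ d z') - T • v.1‖)))
      = ENNReal.ofReal (Real.exp (-R0)) * ENNReal.ofReal (Real.exp (-R1)) *
        ENNReal.ofReal (Real.exp (-(v.2 * T) - A)) *
        ENNReal.ofReal (Real.exp (-(R2 + C * ‖toR d (toZ d z') - T • v.1‖))) := by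
        rw [← ENNReal.ofReal_mul (by positivity), ← ENNReal.ofReal_mul (by positivity),
          ← ENNReal.ofReal_mul (by positivity), ← Real.exp_add, ← Real.exp_add, ← Real.exp_add]
        congr 2
        ring
    _ ≤ reach (step d μ μ0) z 0 * reach (step d μ μ0) (x, 0) (x, N) *
        (reach (step d μ μ0) 0 (x, 0) * reach (step d μ μ0) (x, N) u) *
        reach (step d μ μ0) u z' :=
        mul_le_mul' (mul_le_mul' (mul_le_mul' e0 e1) e2) e3
    _ = (reach (step d μ μ0) z 0 * reach (step d μ μ0) 0 (x, 0)) *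
        (reach (step d μ μ0) (x, 0) (x, N) *
        (reach (step d μ μ0) (x, N) u * reach (step d μ μ0) u z')) := by ring
    _ ≤ reach (step d μ μ0) z (x, 0) * reach (step d μ μ0) (x, 0) z' :=
        mul_le_mul' (reach_mul_le _ _ _ _)
          ((mul_le_mul_right (reach_mul_le _ _ _ _) _).trans (reach_mul_le _ _ _ _))
    _ ≤ reach (step d μ μ0) z z' := reach_mul_le _ _ _ _

lemma green_ne_zero (h1 : H1 d μ μ0) (z z' : St d) : green d μ μ0 z z' ≠ 0 :=
  ((reach_pos h1 z z').trans_le (reach_le_green μ μ0 z z')).ne'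

lemma green_ne_top (hμ : IsProb d μ) (hμ0 : IsProb d μ0) (h : H0 d μ μ0) (h3 : H3 d μ μ0)
    (h4 : H4 d μ μ0) (z z' : St d) : green d μ μ0 z z' ≠ ∞ := by
  obtain ⟨b, η, θ, hη, hθ, hb⟩ := exists_ball_jgf_le hμ hμ0 h3 h4
  have hb0 := hb b (by simpa using hη.le)
  obtain ⟨B, hB, hle⟩ := exists_green_mul_ex_le hμ hμ0 h h4 hθ hb0.1 hb0.2
    (zero_mem_Dhat hμ hμ0) one_pos le_rfl z
  intro htop
  have h5 := hle z'
  rw [htop, ENNReal.top_mul (ex_ne_zero _ _)] at h5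
  exact hB (top_le_iff.1 h5)

lemma eventually_log_green_lt (hμ : IsProb d μ) (hμ0 : IsProb d μ0) (h : H0 d μ μ0)
    (h1 : H1 d μ μ0) (h3 : H3 d μ μ0) (h4 : H4 d μ μ0) {q : Rd d}
    (z : St d) {ε : ℕ → ℝ} {zn : ℕ → St d} (hε : ∀ n, 0 < ε n)
    (hε0 : Tendsto ε atTop (nhds 0))
    (hlim : Tendsto (fun n => ε n • toR d (toZ d (zn n))) atTop (nhds q)) {r : ℝ}
    (hr : -(⨆ a : Dhat d μ μ0, dotR d (a : Rd d) q) < r) :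
    ∀ᶠ n in atTop, ε n * Real.log (green d μ μ0 z (zn n)).toReal < r := by
  obtain ⟨b, η, θ, hη, hθ, hb⟩ := exists_ball_jgf_le hμ hμ0 h3 h4
  have hb0 := hb b (by simpa using hη.le)
  have : Nonempty (Dhat d μ μ0) := ⟨⟨0, zero_mem_Dhat hμ hμ0⟩⟩
  obtain ⟨⟨a, ha⟩, har⟩ := exists_lt_of_lt_ciSup (neg_lt.1 hr)
  obtain ⟨t, htr, ht0, ht1⟩ : ∃ t : ℝ, -r < dotR d ((1 - t) • a + t • b) q ∧ 0 < t ∧ t ≤ 1 := by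
    have hc : Continuous fun t : ℝ => dotR d ((1 - t) • a + t • b) q := by
      simp only [dotR_add_left, dotR_smul_left]
      fun_prop
    have hev := (hc.tendsto 0).eventually_const_lt (u := -r) (by simpa using har)
    obtain ⟨t, ht⟩ := ((hev.filter_mono nhdsWithin_le_nhds).and
      (Ioc_mem_nhdsGT (one_pos (α := ℝ)))).exists
    exact ⟨t, ht.1, ht.2.1, ht.2.2⟩
  set c := (1 - t) • a + t • b
  obtain ⟨B, hB, hle⟩ := exists_green_mul_ex_le hμ hμ0 h h4 hθ hb0.1 hb0.2 ha ht0 ht1 z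
  have hlog : ∀ n, ε n * Real.log (green d μ μ0 z (zn n)).toReal ≤
      ε n * Real.log B.toReal - dotR d c (ε n • toR d (toZ d (zn n))) := by
    intro n
    have hg : 0 < (green d μ μ0 z (zn n)).toReal :=
      ENNReal.toReal_pos (green_ne_zero h1 _ _) (green_ne_top hμ hμ0 h h3 h4 _ _)
    have h5 := ENNReal.toReal_mono hB (hle (zn n))
    rw [ENNReal.toReal_mul, ex, ENNReal.toReal_ofReal (Real.exp_pos _).le] at h5
    have h6 := Real.log_le_log (by positivity) h5
    rw [Real.log_mul hg.ne' (Real.exp_pos _).ne', Real.log_exp] at h6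
    rw [dotR_smul_right, dotR_toR, ← mul_sub]
    exact mul_le_mul_of_nonneg_left (by linarith) (hε n).le
  have hT : Tendsto (fun n => ε n * Real.log B.toReal - dotR d c (ε n • toR d (toZ d (zn n))))
      atTop (nhds (0 * Real.log B.toReal - dotR d c q)) :=
    (hε0.mul_const _).sub (((continuous_dotR c).tendsto q).comp hlim)
  filter_upwards [hT.eventually_lt_const (u := r) (by linarith)] with n hn
  exact (hlog n).trans_lt hn

lemma eventually_lt_log_green (hμ : IsProb d μ) (hμ0 : IsProb d μ0) (h : H0 d μ μ0)
    (h1 : H1 d μ μ0) (h2 : H2 d μ) (h3 : H3 d μ μ0) (h4 : H4 d μ μ0) {q : Rd d} (hq : 0 ≤ q.2)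
    (z : St d) {ε : ℕ → ℝ} {zn : ℕ → St d} (hε : ∀ n, 0 < ε n)
    (hε0 : Tendsto ε atTop (nhds 0))
    (hlim : Tendsto (fun n => ε n • toR d (toZ d (zn n))) atTop (nhds q)) {r : ℝ}
    (hr : r < -(⨆ a : Dhat d μ μ0, dotR d (a : Rd d) q)) :
    ∀ᶠ n in atTop, r < ε n * Real.log (green d μ μ0 z (zn n)).toReal := by
  obtain ⟨C, hC0, hC⟩ := exists_exp_le_reach h h1 h2
  obtain ⟨⟨v, c⟩, hvc, hv⟩ : ∃ v : Rd d × ℝ, v.2 + C * ‖q - v.1‖ < -r ∧ Attained d μ μ0 v := by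
    have hc : Continuous fun v : Rd d × ℝ => v.2 + C * ‖q - v.1‖ := by fun_prop
    obtain ⟨v, hv1, hv2⟩ := mem_closure_iff.1 (mem_closure_attained hμ hμ0 h h1 h2 h3 h4 hq)
      {v | v.2 + C * ‖q - v.1‖ < -r} (isOpen_lt hc continuous_const) (by simpa using lt_neg.1 hr)
    exact ⟨v, hv1, hv2⟩
  obtain ⟨B, hB⟩ := hv.exists_le_reach hC0 hC z
  have hlog : ∀ n, -(c + ε n * B + C * ‖ε n • toR d (toZ d (zn n)) - v‖) ≤
      ε n * Real.log (green d μ μ0 z (zn n)).toReal := by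
    intro n
    have h5 := ENNReal.toReal_mono (green_ne_top hμ hμ0 h h3 h4 _ _)
      ((hB (ε n)⁻¹ (inv_nonneg.2 (hε n).le) (zn n)).trans (reach_le_green μ μ0 _ _))
    rw [ENNReal.toReal_ofReal (Real.exp_pos _).le] at h5
    have h6 := Real.log_le_log (Real.exp_pos _) h5
    rw [Real.log_exp] at h6
    refine le_trans (le_of_eq ?_) (mul_le_mul_of_nonneg_left h6 (hε n).le)
    have h7 : ε n • toR d (toZ d (zn n)) - v =
        ε n • (toR d (toZ d (zn n)) - (ε n)⁻¹ • v) := by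
      rw [smul_sub, smul_inv_smul₀ (hε n).ne']
    rw [h7, norm_smul, Real.norm_of_nonneg (hε n).le]
    have h8 : ε n * (ε n)⁻¹ = 1 := mul_inv_cancel₀ (hε n).ne'
    linear_combination c * h8
  have hT : Tendsto (fun n => -(c + ε n * B + C * ‖ε n • toR d (toZ d (zn n)) - v‖))
      atTop (nhds (-(c + 0 * B + C * ‖q - v‖))) :=
    ((tendsto_const_nhds.add (hε0.mul_const B)).add ((hlim.sub_const v).norm.const_mul C)).neg
  filter_upwards [hT.eventually_const_lt (u := r) (by simp only at hvc; linarith)] with n hn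
  exact hn.trans_le (hlog n)

end Bounds

/-- logarithmic asymptotics of the Green's function `G` of the
reflected walk: `ε_n log G(z,z_n) → -sup_{a∈(Θ×ℝ)∩D} a·q`. -/
theorem log_asymptotics_green
    (d : ℕ) (hd : 2 ≤ d) (μ μ0 : Zd d → ℝ)
    (hμ : IsProb d μ) (hμ0 : IsProb d μ0)
    (hH0 : H0 d μ μ0) (hH1 : H1 d μ μ0) (hH2 : H2 d μ)
    (hH3 : H3 d μ μ0) (hH4 : H4 d μ μ0)
    (q : Rd d) (hq : 0 ≤ q.2)
    (z : St d)
    (ε : ℕ → ℝ) (zn : ℕ → St d)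
    (hε : ∀ n, 0 < ε n)
    (hε0 : Tendsto ε atTop (nhds 0))
    (hlim : Tendsto (fun n => ε n • toR d (toZ d (zn n))) atTop (nhds q)) :
    Tendsto (fun n => ε n * Real.log ((green d μ μ0 z (zn n)).toReal))
      atTop (nhds (-(⨆ a : ↥(Dhat d μ μ0), dotR d (a : Rd d) q))) := by
  exact tendsto_order.2
    ⟨fun _ hr => eventually_lt_log_green hμ hμ0 hH0 hH1 hH2 hH3 hH4 hq z hε hε0 hlim hr,
      fun _ hr => eventually_log_green_lt hμ hμ0 hH0 hH1 hH3 hH4 z hε hε0 hlim hr⟩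

end ReflectedRW
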